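/- For every simplicial set X, the simplicial set Ex^∞ X is a Kan complex and the map ν^∞_X : X → Ex^∞ X is a weak homotopy equivalence. -/

import Mathlib

open CategoryTheory CategoryTheory.Limits MonoidalCategory SSet

noncomputable instance : MonoidalClosed SSet.{0} :=
  (inferInstance : MonoidalClosed (SimplexCategoryᵒᵖ ⥤ Type 0))

namespace Paper

open Simplicial

/-- A map of simplicial sets is a *trivial fibration* if it has the right lifting
property with respect to all boundary inclusions `∂Δ[n] ⟶ Δ[n]` for `n ≥ 0`. -/
def TrivialFibration {X Y : SSet.{0}} (p : X ⟶ Y) : Prop :=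
  ∀ n : ℕ, HasLiftingProperty (SSet.boundary n).ι p

/-- A map of simplicial sets is a *Kan fibration* if it has the right lifting property
with respect to all horn inclusions `Λ[n, i] ⟶ Δ[n]` for `n ≥ 1`, `0 ≤ i ≤ n`. -/
def KanFibration {X Y : SSet.{0}} (p : X ⟶ Y) : Prop :=
  ∀ (n : ℕ) (i : Fin (n + 2)), HasLiftingProperty (SSet.horn (n + 1) i).ι p

/-- An *anodyne* map is one with the left lifting property with respect to
all Kan fibrations. -/
def Anodyne {A B : SSet.{0}} (i : A ⟶ B) : Prop :=
  ∀ ⦃X Y : SSet.{0}⦄ (p : X ⟶ Y), KanFibration p → HasLiftingProperty i p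

/-- The unique map to `Δ[0]`. -/
def toPt (X : SSet.{0}) : X ⟶ Δ[0] where
  app m := ↾fun _ => SSet.stdSimplex.const 0 0 m
  naturality := by
    intro m m' φ
    apply ConcreteCategory.hom_ext
    intro x
    apply stdSimplex.objEquiv.injective
    apply SimplexCategory.Hom.ext
    apply OrderHom.ext
    funext j
    exact @Subsingleton.elim (Fin 1) _ _ _

/-- A *Kan complex* is a simplicial set whose map to `Δ[0]` is a Kan fibration. -/
def KanComplex (X : SSet.{0}) : Prop :=
  KanFibration (toPt X)

/-- The constant map at the vertex `k` of `Δ[1]`. -/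
def cst (X : SSet.{0}) (k : Fin 2) : X ⟶ Δ[1] where
  app m := ↾fun _ => SSet.stdSimplex.const 1 k m
  naturality := by
    intro m m' φ
    apply ConcreteCategory.hom_ext
    intro x
    apply stdSimplex.objEquiv.injective
    apply SimplexCategory.Hom.ext
    ext j
    rfl

/-- The endpoint inclusion `X ⟶ X ⊗ Δ[1]` at the vertex `k` of `Δ[1]`. -/
noncomputable def ept (X : SSet.{0}) (k : Fin 2) : X ⟶ X ⊗ Δ[1] :=
  CartesianMonoidalCategory.lift (𝟙 X) (cst X k)

/-- A (single-step) homotopy from `f` to `g`, as a property of the pair `(f, g)`. -/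
def Homotopy {X Y : SSet.{0}} (f g : X ⟶ Y) : Prop :=
  ∃ H : X ⊗ Δ[1] ⟶ Y, ept X 0 ≫ H = f ∧ ept X 1 ≫ H = g

/-- `f` and `g` are *homotopic* if they are connected by a zig-zag of homotopies. -/
def Homotopic {X Y : SSet.{0}} (f g : X ⟶ Y) : Prop :=
  Relation.EqvGen Homotopy f g

/-- A *homotopy equivalence* of simplicial sets. -/
def HomotopyEquivalence {X Y : SSet.{0}} (f : X ⟶ Y) : Prop :=
  ∃ g : Y ⟶ X, Homotopic (f ≫ g) (𝟙 X) ∧ Homotopic (g ≫ f) (𝟙 Y)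

/-- A map `f : X ⟶ Y` is a *weak homotopy equivalence* if for every Kan complex `K`
the induced map `K^Y ⟶ K^X` on exponentials is a homotopy equivalence. -/
def WeakHomotopyEquivalence {X Y : SSet.{0}} (f : X ⟶ Y) : Prop :=
  ∀ K : SSet.{0}, KanComplex K → HomotopyEquivalence ((MonoidalClosed.pre f).app K)

/-- A homotopy `H` between maps over `B` which is *fiberwise over `B`*. -/
def FibHomotopy {B X Y : SSet.{0}} (pX : X ⟶ B) (pY : Y ⟶ B) (f g : X ⟶ Y) : Prop :=
  ∃ H : X ⊗ Δ[1] ⟶ Y, ept X 0 ≫ H = f ∧ ept X 1 ≫ H = g ∧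
    H ≫ pY = CartesianMonoidalCategory.fst X Δ[1] ≫ pX

/-- Connectedness by a zig-zag of fiberwise homotopies over `B`. -/
def FibHomotopic {B X Y : SSet.{0}} (pX : X ⟶ B) (pY : Y ⟶ B) (f g : X ⟶ Y) : Prop :=
  Relation.EqvGen (FibHomotopy pX pY) f g

/-- A *fiberwise homotopy equivalence over `B`*. -/
def FibHomotopyEquivalence {B X Y : SSet.{0}} (pX : X ⟶ B) (pY : Y ⟶ B) (f : X ⟶ Y) : Prop :=
  f ≫ pY = pX ∧ ∃ g : Y ⟶ X, g ≫ pX = pY ∧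
    FibHomotopic pX pX (f ≫ g) (𝟙 X) ∧ FibHomotopic pY pY (g ≫ f) (𝟙 Y)

end Paper

namespace Paper

/-- The barycentric subdivision poset `sd [m]` of nonempty subsets of `[m]`,
ordered by inclusion. -/
def sd (m : SimplexCategory) : Type :=
  {S : Finset (Fin (m.len + 1)) // S.Nonempty}

instance (m : SimplexCategory) : PartialOrder (sd m) :=
  inferInstanceAs (PartialOrder {S : Finset (Fin (m.len + 1)) // S.Nonempty})

/-- The action of a simplicial operator on the subdivision posets, by taking images. -/
def sdMap {m n : SimplexCategory} (f : m ⟶ n) : sd m →o sd n where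
  toFun S := ⟨S.1.image f.toOrderHom, S.2.image _⟩
  monotone' := fun S T h => Finset.image_subset_image h

/-- Barycentric subdivision of simplices, as a functor to `Cat`. -/
def sdFunctor : SimplexCategory ⥤ Cat.{0, 0} where
  obj m := Cat.of (sd m)
  map f := (sdMap f).monotone.functor.toCatHom
  map_id m := by
    have hobj : ∀ S : sd m, (sdMap (𝟙 m)).monotone.functor.obj S = S := by
      intro S
      apply Subtype.ext
      exact Finset.image_id
    apply Cat.ext
    exact CategoryTheory.Functor.ext hobj
  map_comp {a b c} f g := by
    have hobj : ∀ S : sd a, (sdMap (f ≫ g)).monotone.functor.obj S =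
        ((sdMap f).monotone.functor ⋙ (sdMap g).monotone.functor).obj S := by
      intro S
      apply Subtype.ext
      exact (Finset.image_image (s := S.1) (f := f.toOrderHom) (g := g.toOrderHom)).symm
    apply Cat.ext
    exact CategoryTheory.Functor.ext hobj

/-- `Sd Δ[m] = N(sd [m])`, functorially in `[m]`. -/
def SdS : SimplexCategory ⥤ SSet.{0} := sdFunctor ⋙ nerveFunctor

/-- Kan's functor `Ex`, right adjoint to subdivision: `(Ex X)_m = Hom(Sd Δ[m], X)`. -/
def Ex : SSet.{0} ⥤ SSet.{0} where
  obj X := SdS.op ⋙ yoneda.obj X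
  map f := Functor.whiskerLeft SdS.op (yoneda.map f)

/-- The simplicial operator `[e] ⟶ [m]` taking `i` to the maximum of the `i`-th
subset in a chain of subsets of `[m]`. -/
def maxChain {m : SimplexCategory} {e : ℕ} (c : ComposableArrows (sd m) e) :
    (SimplexCategory.mk e : SimplexCategory) ⟶ m :=
  SimplexCategory.Hom.mk
    { toFun := fun i => (c.obj i).1.max' (c.obj i).2
      monotone' := fun i j hij => Finset.max'_subset _ (leOfHom (c.map (homOfLE hij))) }

/-- The natural map `ν_X : X ⟶ Ex X`, adjoint transpose of `μ : Sd ⟶ id`. -/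
def nu (X : SSet.{0}) : X ⟶ Ex.obj X where
  app m := ↾fun x =>
    { app := fun k => ↾fun c => X.map (maxChain c).op x
      naturality := by
        intro k k' β
        apply ConcreteCategory.hom_ext
        intro c
        show X.map (maxChain (c.whiskerLeft (SimplexCategory.toCat.map β.unop).toFunctor)).op x
          = X.map β (X.map (maxChain c).op x)
        rw [← FunctorToTypes.map_comp_apply]
        congr 1 }
  naturality := by
    intro m m' γ
    apply ConcreteCategory.hom_ext
    intro x
    apply NatTrans.ext
    funext k
    apply ConcreteCategory.hom_ext
    intro c
    show X.map (maxChain c).op (X.map γ x)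
      = X.map (maxChain ((SdS.map γ.unop).app k c)).op x
    have h : maxChain ((SdS.map γ.unop).app k c) = maxChain c ≫ γ.unop := by
      apply SimplexCategory.Hom.ext
      apply OrderHom.ext
      funext i
      apply le_antisymm
      · apply Finset.max'_le
        · exact (((SdS.map γ.unop).app k c).obj i).2
        intro y hy
        obtain ⟨a, ha, rfl⟩ := Finset.mem_image.mp hy
        exact γ.unop.toOrderHom.monotone
          (show a ≤ (c.obj i).1.max' (c.obj i).2 from Finset.le_max' _ _ ha)
      · apply Finset.le_max'
        exact Finset.mem_image_of_mem _ (Finset.max'_mem (c.obj i).1 (c.obj i).2)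
    rw [h, op_comp, FunctorToTypes.map_comp_apply]
    rfl

/-- The iterates `Ex^k X`. -/
def ExIter (X : SSet.{0}) : ℕ → SSet.{0}
  | 0 => X
  | (n + 1) => Ex.obj (ExIter X n)

/-- The sequence `X ⟶ Ex X ⟶ Ex² X ⟶ ⋯` given by `ν`. -/
def ExInftyDiagram (X : SSet.{0}) : ℕ ⥤ SSet.{0} :=
  Functor.ofSequence (fun n => nu (ExIter X n))

/-- `Ex^∞ X`, the colimit of `X ⟶ Ex X ⟶ Ex² X ⟶ ⋯`. -/
noncomputable def ExInfty (X : SSet.{0}) : SSet.{0} :=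
  colimit (ExInftyDiagram X)

/-- The canonical map `ν^∞ : X ⟶ Ex^∞ X`. -/
noncomputable def nuInfty (X : SSet.{0}) : X ⟶ ExInfty X :=
  colimit.ι (ExInftyDiagram X) 0

end Paper

namespace Paper

section Nerve

variable {P : Type} [PartialOrder P]

/-- The sequence of vertices of a simplex of the nerve of a partially ordered type. -/
def nerveObj {m : SimplexCategoryᵒᵖ} (s : (nerve P).obj m) (i : Fin (m.unop.len + 1)) : P :=
  Functor.obj (C := Fin (m.unop.len + 1)) (D := P) s i

lemma monotone_nerveObj {m : SimplexCategoryᵒᵖ} (s : (nerve P).obj m) :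
    Monotone (nerveObj s) := fun _ _ hij =>
  leOfHom (CategoryTheory.Functor.map (C := Fin (m.unop.len + 1)) (D := P) s (homOfLE hij))

lemma nerve_ext {m : SimplexCategoryᵒᵖ} {s t : (nerve P).obj m}
    (h : ∀ i, nerveObj s i = nerveObj t i) : s = t :=
  nerve.ext_of_isThin (funext h)

/-- The simplex of the nerve of a partially ordered type given by a monotone sequence. -/
def nerveMk {m : SimplexCategoryᵒᵖ} (s : Fin (m.unop.len + 1) → P) (hs : Monotone s) :
    (nerve P).obj m :=
  hs.functor

end Nerve

section Toggle

open Simplicial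

variable {P : Type}

/-- The set of vertices of a simplex of the nerve of a partially ordered type. -/
noncomputable def nerveVertices {n : ℕ} (s : Fin (n + 1) → P) : Finset P :=
  open scoped Classical in Finset.univ.image s

lemma mem_nerveVertices {n : ℕ} (s : Fin (n + 1) → P) (x : P) :
    x ∈ nerveVertices s ↔ ∃ i, s i = x := by
  classical simp [nerveVertices]

lemma card_nerveVertices {n : ℕ} {s : Fin (n + 1) → P} (hs : Function.Injective s) :
    (nerveVertices s).card = n + 1 := by
  classical simp [nerveVertices, Finset.card_image_of_injective _ hs]

variable [PartialOrder P]

lemma existsUnique_mono_of_nerveVertices_subset {a b : ℕ} {s : Fin (a + 1) → P}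
    {t : Fin (b + 1) → P} (hs : StrictMono s) (ht : StrictMono t)
    (h : nerveVertices s ⊆ nerveVertices t) :
    ∃! f : ⦋a⦌ ⟶ ⦋b⦌, Mono f ∧ ∀ i, t (f.toOrderHom i) = s i := by
  have h' : ∀ i, ∃ j, t j = s i := fun i =>
    (mem_nerveVertices t _).1 (h ((mem_nerveVertices s _).2 ⟨i, rfl⟩))
  choose f hf using h'
  have hmono : StrictMono f := fun i j hij => by
    rw [← ht.lt_iff_lt, hf, hf]; exact hs hij
  refine ⟨SimplexCategory.Hom.mk ⟨f, hmono.monotone⟩, ⟨?_, hf⟩, ?_⟩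
  · rw [SimplexCategory.mono_iff_injective]
    exact hmono.injective
  · rintro g ⟨_, hg⟩
    ext i : 3
    exact ht.injective ((hg i).trans (hf i).symm)

lemma exists_strictMono_nerveVertices_eq {c : Finset P} (hc : c.Nonempty)
    (hc' : IsChain (· ≤ ·) (c : Set P)) :
    ∃ (n : ℕ) (s : Fin (n + 1) → P), StrictMono s ∧ nerveVertices s = c := by
  classical
  let _ : LinearOrder (c : Set P) := hc'.linearOrder
  obtain ⟨n, hn⟩ : ∃ n, c.card = n + 1 := ⟨c.card - 1, by have := hc.card_pos; omega⟩
  let e : Fin (n + 1) ≃o (c : Set P) := Fintype.orderIsoFinOfCardEq (c : Set P) (by simp [hn])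
  refine ⟨n, fun i => (e i).1, fun i j hij => ?_, ?_⟩
  · exact e.strictMono hij
  · ext x
    rw [mem_nerveVertices]
    constructor
    · rintro ⟨i, rfl⟩; exact (e i).2
    · intro hx
      exact ⟨e.symm ⟨x, hx⟩, by simp⟩


section

variable {A : (nerve P).Subcomplex}

/-- The set of vertices of a nondegenerate simplex which is not in a subcomplex. -/
noncomputable def verticesN (x : A.N) : Finset P :=
  nerveVertices (nerveObj x.simplex)

lemma strictMono_obj (x : A.N) : StrictMono (nerveObj x.simplex) :=
  (PartialOrder.mem_nerve_nonDegenerate_iff_strictMono _).1 x.nonDegenerate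

lemma card_verticesN (x : A.N) : (verticesN x).card = x.dim + 1 :=
  card_nerveVertices (strictMono_obj x).injective

lemma existsUnique_mono_map_eq {x y : A.N} (h : verticesN x ⊆ verticesN y) :
    ∃! f : ⦋x.dim⦌ ⟶ ⦋y.dim⦌, Mono f ∧ (nerve P).map f.op y.simplex = x.simplex := by
  convert existsUnique_mono_of_nerveVertices_subset (strictMono_obj x) (strictMono_obj y) h
    using 4 with f
  exact ⟨fun h i => by rw [← h]; rfl, fun h => nerve.ext_of_isThin (funext h)⟩

lemma le_iff_verticesN_subset {x y : A.N} : x ≤ y ↔ verticesN x ⊆ verticesN y := by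
  rw [Subcomplex.N.le_iff, SSet.N.le_iff_exists_mono]
  constructor
  · rintro ⟨f, _, hf⟩ p hp
    obtain ⟨i, rfl⟩ := (mem_nerveVertices (nerveObj x.simplex) _).1 hp
    refine (mem_nerveVertices (nerveObj y.simplex) _).2 ⟨f.toOrderHom i, ?_⟩
    rw [← hf]
    rfl
  · intro h
    obtain ⟨f, hf, -⟩ := existsUnique_mono_map_eq h
    exact ⟨f, hf.1, hf.2⟩

lemma verticesN_injective : Function.Injective (verticesN (A := A)) := fun _ _ h =>
  le_antisymm (le_iff_verticesN_subset.2 h.subset) (le_iff_verticesN_subset.2 h.superset)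

end

open scoped Classical in
/-- If a subcomplex `A` of the nerve of a partially ordered type is determined by a property
of the sets of vertices, and if finite chains not in `A` are paired by inserting or removing
a vertex, in such a way that some function decreases along the ancestrality relation, then
the inclusion of `A` is an anodyne extension. -/
theorem anodyneExtensions_of_toggle (A : (nerve P).Subcomplex) (B : Finset P → Prop)
    (hA : ∀ (n : ℕ) (s : (nerve P) _⦋n⦌), s ∉ A.obj _ ↔ B (nerveVertices (nerveObj s)))
    (hne : ∀ c, B c → c.Nonempty)
    (t : Finset P → P) (r : Finset P → ℕ)
    (hI : ∀ c : Finset P, IsChain (· ≤ ·) (c : Set P) → B c → t c ∉ c →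
      IsChain (· ≤ ·) ((insert (t c) c : Finset P) : Set P) ∧ B (insert (t c) c) ∧
        t (insert (t c) c) = t c)
    (hE : ∀ c : Finset P, IsChain (· ≤ ·) (c : Set P) → B c → t c ∈ c →
      B (c.erase (t c)) ∧ t (c.erase (t c)) = t c)
    (hr : ∀ c : Finset P, IsChain (· ≤ ·) (c : Set P) → B c → t c ∈ c → ∀ x ∈ c, x ≠ t c →
      B (c.erase x) → t (c.erase x) ∉ c.erase x → r (c.erase x) < r (c.erase (t c))) :
    anodyneExtensions A.ι := by
  have hB (x : A.N) : B (verticesN x) := (hA _ _).1 x.notMem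
  have hC (x : A.N) : IsChain (· ≤ ·) (verticesN x : Set P) := by
    intro a ha b hb _
    obtain ⟨i, rfl⟩ := (mem_nerveVertices (nerveObj x.simplex) _).1 ha
    obtain ⟨j, rfl⟩ := (mem_nerveVertices (nerveObj x.simplex) _).1 hb
    exact (le_total i j).imp (fun h => (strictMono_obj x).monotone h)
      (fun h => (strictMono_obj x).monotone h)
  have hsurj (c : Finset P) (hc : IsChain (· ≤ ·) (c : Set P)) (hc' : B c) :
      ∃ x : A.N, verticesN x = c := by
    obtain ⟨n, s, hs, rfl⟩ := exists_strictMono_nerveVertices_eq (hne c hc') hc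
    exact ⟨Subcomplex.N.mk (n := n) (nerveMk (m := Opposite.op ⦋n⦌) s hs.monotone)
      ((PartialOrder.mem_nerve_nonDegenerate_iff_strictMono _).2 hs) ((hA _ _).2 hc'), rfl⟩
  let I : Set A.N := {x | t (verticesN x) ∈ verticesN x}
  let II : Set A.N := {x | t (verticesN x) ∉ verticesN x}
  have hins (x : II) : ∃ y : A.N, verticesN y = insert (t (verticesN x.1)) (verticesN x.1) :=
    hsurj _ (hI _ (hC _) (hB _) x.2).1 (hI _ (hC _) (hB _) x.2).2.1
  have hera (x : I) : ∃ y : A.N, verticesN y = (verticesN x.1).erase (t (verticesN x.1)) :=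
    hsurj _ ((hC x).mono (by simp)) (hE _ (hC _) (hB _) x.2).1
  choose ins hins using hins
  choose era hera using hera
  have htins (x : II) : t (verticesN (ins x)) = t (verticesN x.1) := by
    rw [hins]; exact (hI _ (hC _) (hB _) x.2).2.2
  have htera (x : I) : t (verticesN (era x)) = t (verticesN x.1) := by
    rw [hera]; exact (hE _ (hC _) (hB _) x.2).2
  let p : II ≃ I :=
    { toFun x := ⟨ins x, by
        show t (verticesN (ins x)) ∈ verticesN (ins x)
        rw [htins, hins]; simp⟩
      invFun x := ⟨era x, by
        show t (verticesN (era x)) ∉ verticesN (era x)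
        rw [htera, hera]; simp⟩
      left_inv x := by
        apply Subtype.ext
        apply verticesN_injective
        rw [hera, htins, hins, Finset.erase_insert x.2]
      right_inv x := by
        apply Subtype.ext
        apply verticesN_injective
        rw [hins, htera, hera, Finset.insert_erase x.2] }
  let Q : A.Pairing :=
    { I := I
      II := II
      inter := by ext x; simp [I, II]
      union := by ext x; simp [I, II, em]
      p := p }
  have hp (x : Q.II) : verticesN (Q.p x).1 = insert (t (verticesN x.1)) (verticesN x.1) := hins x
  have : Q.IsProper := ⟨fun x => ⟨by
      have h := card_verticesN (Q.p x).1
      rw [hp, Finset.card_insert_of_notMem x.2, card_verticesN] at h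
      simpa using h.symm,
    existsUnique_mono_map_eq (by rw [hp]; exact Finset.subset_insert _ _)⟩⟩
  let w : Q.WeakRankFunction ℕ :=
    { rank x := r (verticesN x.1)
      lt {x y} hxy hdim := by
        have hsub : verticesN x.1 ⊆ verticesN (Q.p y).1 := le_iff_verticesN_subset.1 hxy.2.le
        have hcard : (verticesN x.1).card + 1 = (verticesN (Q.p y).1).card := by
          rw [card_verticesN, card_verticesN, Q.dim_p, hdim]
        obtain ⟨z, hz, hz'⟩ : ∃ z ∈ verticesN (Q.p y).1,
            verticesN x.1 = (verticesN (Q.p y).1).erase z := by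
          obtain ⟨z, hz⟩ := Finset.covBy_iff_exists_insert.1
            ((Finset.covBy_iff_card_sdiff_eq_one).2 ⟨hsub, by
              rw [Finset.card_sdiff_of_subset hsub]; omega⟩)
          refine ⟨z, by rw [← hz.2]; simp, ?_⟩
          rw [← hz.2, Finset.erase_insert hz.1]
        have ht : t (verticesN (Q.p y).1) = t (verticesN y.1) := htins y
        have hy : verticesN y.1 = (verticesN (Q.p y).1).erase (t (verticesN (Q.p y).1)) := by
          rw [ht, hp, Finset.erase_insert y.2]
        have hzt : z ≠ t (verticesN (Q.p y).1) := by
          rintro rfl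
          exact hxy.1 (Subtype.ext (verticesN_injective (hz'.trans hy.symm)))
        rw [hy, hz']
        exact hr _ (hC _) (hB _) (Q.p y).2 z hz hzt
          (by rw [← hz']; exact hB x.1) (by rw [← hz']; exact x.2) }
  have := w.isRegular
  exact Q.anodyneExtensions

end Toggle

/-- The points of the poset whose nerve is the mapping cylinder of `max : sd [m] → [m]`: it
is the disjoint union of `sd [m]` and `[m]`, where `S ≤ j` if and only if `max S ≤ j`. -/
inductive CylPt (m : SimplexCategory) : Type
  | face (S : sd m) : CylPt m
  | vert (j : Fin (m.len + 1)) : CylPt m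

namespace CylPt

variable {m n : SimplexCategory}

/-- An injection of `CylPt m` in a partially ordered type, which defines the order. -/
def toProd : CylPt m → Finset (Fin (m.len + 1)) × Bool
  | face S => (S.1, false)
  | vert j => (Finset.Iic j, true)

lemma toProd_injective : Function.Injective (toProd (m := m)) := by
  rintro (S | j) (T | k) h
  · simp only [toProd, Prod.mk.injEq, and_true] at h
    exact congrArg face (Subtype.ext h)
  · simp [toProd] at h
  · simp [toProd] at h
  · simp only [toProd, Prod.mk.injEq, and_true] at h
    refine congrArg vert (le_antisymm ?_ ?_)
    · exact Finset.mem_Iic.1 (h ▸ Finset.mem_Iic.2 le_rfl)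
    · exact Finset.mem_Iic.1 (h ▸ Finset.mem_Iic.2 le_rfl)

instance : PartialOrder (CylPt m) := PartialOrder.lift toProd toProd_injective

@[simp]
lemma face_le_face {S T : sd m} : face S ≤ face T ↔ S.1 ⊆ T.1 := by
  show toProd _ ≤ toProd _ ↔ _
  simp [toProd]

@[simp]
lemma face_le_vert {S : sd m} {j : Fin (m.len + 1)} :
    face S ≤ vert j ↔ ∀ x ∈ S.1, x ≤ j := by
  show toProd _ ≤ toProd _ ↔ _
  simp [toProd, Finset.subset_iff]

@[simp]
lemma not_vert_le_face {S : sd m} {j : Fin (m.len + 1)} : ¬ vert j ≤ face S := by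
  show ¬ toProd _ ≤ toProd _
  simp [toProd]

@[simp]
lemma vert_le_vert {j k : Fin (m.len + 1)} : (vert j : CylPt m) ≤ vert k ↔ j ≤ k := by
  show toProd _ ≤ toProd _ ↔ _
  simp [toProd]

/-- The set of vertices of `[m]` involved in a point of the cylinder. -/
def supp : CylPt m → Finset (Fin (m.len + 1))
  | face S => S.1
  | vert j => {j}

lemma supp_nonempty (c : CylPt m) : c.supp.Nonempty := by
  obtain S | j := c
  · exact S.2
  · exact Finset.singleton_nonempty j

/-- The functoriality of the cylinder. -/
def map (f : m ⟶ n) : CylPt m →o CylPt n where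
  toFun
    | face S => face (sdMap f S)
    | vert j => vert (f.toOrderHom j)
  monotone' := by
    rintro (S | j) (T | k) h
    · exact face_le_face.2 (Finset.image_subset_image (face_le_face.1 h))
    · refine face_le_vert.2 fun x hx => ?_
      obtain ⟨y, hy, rfl⟩ := Finset.mem_image.1 hx
      exact f.toOrderHom.monotone (face_le_vert.1 h y hy)
    · exact (not_vert_le_face h).elim
    · exact vert_le_vert.2 (f.toOrderHom.monotone (vert_le_vert.1 h))

lemma supp_map (f : m ⟶ n) (c : CylPt m) : (map f c).supp = c.supp.image f.toOrderHom := by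
  obtain S | j := c <;> rfl

section Toggle

open scoped Classical

variable (c c' : Finset (CylPt m))

/-- The smallest element of `[m]` in a set of points of the cylinder. -/
noncomputable def minVert : Fin (m.len + 1) :=
  if h : (Finset.univ.filter fun j => vert j ∈ c).Nonempty then Finset.min' _ h else 0

/-- The faces in `c` which do not contain `minVert c`. -/
noncomputable def lowFaces : Finset (Finset (Fin (m.len + 1))) :=
  Finset.univ.filter fun S => minVert c ∉ S ∧ ∃ T : sd m, T.1 = S ∧ face T ∈ c

/-- The face which is inserted in or removed from `c`. -/
noncomputable def toggle : CylPt m :=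
  face ⟨insert (minVert c) ((lowFaces c).biUnion id), Finset.insert_nonempty _ _⟩

/-- A rank function which is compatible with the pairing defined by `toggle`. -/
noncomputable def rank : ℕ :=
  (m.len - minVert c) * (Fintype.card (Finset (Fin (m.len + 1))) + 1) + (lowFaces c).card

/-- The chains that are not in `cylBase m`. -/
def IsInterior : Prop := (∃ j, vert j ∈ c) ∧ c.biUnion supp = Finset.univ

variable {c c'}

lemma vert_minVert_mem (hc : ∃ j, vert j ∈ c) : vert (minVert c) ∈ c := by
  have h : (Finset.univ.filter fun j => vert j ∈ c).Nonempty := by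
    obtain ⟨j, hj⟩ := hc
    exact ⟨j, by simpa using hj⟩
  rw [minVert, dif_pos h]
  simpa using Finset.min'_mem _ h

lemma minVert_le {j : Fin (m.len + 1)} (hj : vert j ∈ c) : minVert c ≤ j := by
  have h : (Finset.univ.filter fun j => vert j ∈ c).Nonempty := ⟨j, by simpa using hj⟩
  rw [minVert, dif_pos h]
  exact Finset.min'_le _ _ (by simpa using hj)

lemma minVert_congr (h : ∀ j, vert j ∈ c ↔ vert j ∈ c') : minVert c = minVert c' := by
  simp [minVert, h]

lemma mem_lowFaces {S : Finset (Fin (m.len + 1))} :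
    S ∈ lowFaces c ↔ minVert c ∉ S ∧ ∃ T : sd m, T.1 = S ∧ face T ∈ c := by
  simp [lowFaces]

lemma lowFaces_congr (h : minVert c = minVert c')
    (h' : ∀ S : sd m, minVert c ∉ S.1 → (face S ∈ c ↔ face S ∈ c')) :
    lowFaces c = lowFaces c' := by
  ext S
  rw [mem_lowFaces, mem_lowFaces, ← h]
  refine and_congr_right fun hS => exists_congr fun T => and_congr_right fun hT => ?_
  exact h' T (hT ▸ hS)

lemma toggle_congr (h : minVert c = minVert c') (h' : lowFaces c = lowFaces c') :
    toggle c = toggle c' := by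
  unfold toggle
  simp only [h, h']

lemma face_eq_toggle_iff {S : sd m} : face S = toggle c ↔
    S.1 = insert (minVert c) ((lowFaces c).biUnion id) := by
  exact ⟨fun h => congrArg Subtype.val (face.inj h), fun h => congrArg face (Subtype.ext h)⟩

lemma minVert_insert_toggle : minVert (insert (toggle c) c) = minVert c :=
  minVert_congr fun j => by simp [toggle]

lemma lowFaces_insert_toggle : lowFaces (insert (toggle c) c) = lowFaces c := by
  refine lowFaces_congr minVert_insert_toggle fun S hS => ?_
  rw [minVert_insert_toggle] at hS
  rw [Finset.mem_insert, face_eq_toggle_iff, or_iff_right]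
  intro h
  exact hS (by simp [h])

lemma minVert_erase_toggle : minVert (c.erase (toggle c)) = minVert c :=
  minVert_congr fun j => by simp [toggle]

lemma lowFaces_erase_toggle : lowFaces (c.erase (toggle c)) = lowFaces c := by
  refine lowFaces_congr minVert_erase_toggle fun S hS => ?_
  rw [minVert_erase_toggle] at hS
  rw [Finset.mem_erase, Ne, face_eq_toggle_iff, and_iff_right]
  intro h
  exact hS (by simp [h])

lemma le_minVert (hc : IsChain (· ≤ ·) (c : Set (CylPt m))) (hc' : ∃ j, vert j ∈ c) {S : sd m}
    (hS : face S ∈ c) {x : Fin (m.len + 1)} (hx : x ∈ S.1) : x ≤ minVert c := by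
  obtain h | h := hc.total hS (vert_minVert_mem hc')
  · exact face_le_vert.1 h x hx
  · exact (not_vert_le_face h).elim

lemma isChain_insert_toggle (hc : IsChain (· ≤ ·) (c : Set (CylPt m)))
    (hc' : ∃ j, vert j ∈ c) :
    IsChain (· ≤ ·) ((insert (toggle c) c : Finset (CylPt m)) : Set (CylPt m)) := by
  rw [Finset.coe_insert]
  refine hc.insert fun b hb _ => ?_
  obtain S | j := b
  · by_cases hS : minVert c ∈ S.1
    · left
      refine face_le_face.2 (Finset.insert_subset hS (Finset.biUnion_subset.2 fun T hT => ?_))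
      obtain ⟨hT, T, rfl, hTc⟩ := mem_lowFaces.1 hT
      obtain h | h := hc.total hTc hb
      · exact face_le_face.1 h
      · exact (hT (face_le_face.1 h hS)).elim
    · right
      refine face_le_face.2 (subset_trans ?_ (Finset.subset_insert _ _))
      exact Finset.subset_biUnion_of_mem id (mem_lowFaces.2 ⟨hS, S, rfl, hb⟩)
  · left
    refine face_le_vert.2 fun x hx => ?_
    refine le_trans ?_ (minVert_le hb)
    obtain rfl | hx := Finset.mem_insert.1 hx
    · rfl
    · obtain ⟨T, hT, hx⟩ := Finset.mem_biUnion.1 hx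
      obtain ⟨hT, T, rfl, hTc⟩ := mem_lowFaces.1 hT
      exact le_minVert hc hc' hTc hx

lemma isInterior_erase_toggle (hc : IsInterior c) : IsInterior (c.erase (toggle c)) := by
  have hp : vert (minVert c) ∈ c.erase (toggle c) :=
    Finset.mem_erase.2 ⟨by simp [toggle], vert_minVert_mem hc.1⟩
  refine ⟨⟨_, hp⟩, Finset.eq_univ_of_forall fun x => ?_⟩
  have hx := Finset.mem_univ x
  rw [← hc.2, Finset.mem_biUnion] at hx
  obtain ⟨a, ha, hx⟩ := hx
  by_cases h : a = toggle c
  · subst h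
    obtain rfl | hx := Finset.mem_insert.1 hx
    · exact Finset.mem_biUnion.2 ⟨_, hp, Finset.mem_singleton_self _⟩
    · obtain ⟨T, hT, hx⟩ := Finset.mem_biUnion.1 hx
      obtain ⟨hT, T, rfl, hTc⟩ := mem_lowFaces.1 hT
      refine Finset.mem_biUnion.2 ⟨face T, Finset.mem_erase.2 ⟨?_, hTc⟩, hx⟩
      rw [Ne, face_eq_toggle_iff]
      intro h
      simp [h] at hT
  · exact Finset.mem_biUnion.2 ⟨a, Finset.mem_erase.2 ⟨h, ha⟩, hx⟩

lemma rank_erase_lt (ht : toggle c ∈ c) {x : CylPt m} (hx : x ∈ c)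
    (hxt : x ≠ toggle c) (hx' : IsInterior (c.erase x)) (ht' : toggle (c.erase x) ∉ c.erase x) :
    rank (c.erase x) < rank (c.erase (toggle c)) := by
  have key (h : toggle (c.erase x) = toggle c) : False :=
    ht' (by rw [h]; exact Finset.mem_erase.2 ⟨hxt.symm, ht⟩)
  rw [rank, rank, minVert_erase_toggle, lowFaces_erase_toggle]
  obtain S | j := x
  · have hmin : minVert (c.erase (face S)) = minVert c := minVert_congr fun j => by simp
    have hS : minVert c ∉ S.1 := fun hS => by
      refine key (toggle_congr hmin (lowFaces_congr hmin fun T hT => ?_))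
      rw [Finset.mem_erase, and_iff_right]
      rintro h
      obtain rfl := face.inj h
      exact hT (hmin ▸ hS)
    rw [hmin]
    refine Nat.add_lt_add_left (Finset.card_lt_card ?_) _
    rw [Finset.ssubset_iff_of_subset]
    · exact ⟨S.1, mem_lowFaces.2 ⟨hS, S, rfl, hx⟩, fun h => by
        obtain ⟨_, T, h', h⟩ := mem_lowFaces.1 h
        obtain rfl := Subtype.ext h'
        simp at h⟩
    · intro T hT
      obtain ⟨hT, T, rfl, hTc⟩ := mem_lowFaces.1 hT
      exact mem_lowFaces.2 ⟨by rwa [← hmin], T, rfl, Finset.mem_of_mem_erase hTc⟩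
  · have hmem := vert_minVert_mem hx'.1
    have hlt : minVert c < minVert (c.erase (vert j)) := by
      refine lt_of_le_of_ne (minVert_le (Finset.mem_of_mem_erase hmem)) fun h => ?_
      exact key (toggle_congr h.symm (lowFaces_congr h.symm fun S _ => by simp))
    have h1 : m.len - (minVert c : ℕ) ≥ m.len - (minVert (c.erase (vert j)) : ℕ) + 1 := by
      have := (minVert (c.erase (vert j))).2
      have : (minVert c : ℕ) < minVert (c.erase (vert j)) := hlt
      omega
    have h2 : (lowFaces (c.erase (vert j))).card ≤ Fintype.card (Finset (Fin (m.len + 1))) :=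
      Finset.card_le_univ _
    have h3 := Nat.mul_le_mul_right (Fintype.card (Finset (Fin (m.len + 1))) + 1) h1
    rw [add_mul, one_mul] at h3
    omega

end Toggle

end CylPt

/-- The cylinder of `max : sd [m] → [m]`, as a cosimplicial simplicial set. -/
def CylS : SimplexCategory ⥤ SSet.{0} where
  obj m := nerve (CylPt m)
  map f := nerveMap (CylPt.map f).monotone.functor
  map_id m := by
    apply NatTrans.ext
    funext k
    apply ConcreteCategory.hom_ext
    intro c
    refine nerve_ext (P := CylPt m) fun i => ?_
    show CylPt.map (𝟙 m) (nerveObj c i) = nerveObj c i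
    obtain S | j := nerveObj c i
    · exact congrArg CylPt.face (Subtype.ext Finset.image_id)
    · rfl
  map_comp {m n p} f g := by
    apply NatTrans.ext
    funext k
    apply ConcreteCategory.hom_ext
    intro c
    refine nerve_ext (P := CylPt p) fun i => ?_
    show CylPt.map (f ≫ g) (nerveObj c i) = CylPt.map g (CylPt.map f (nerveObj c i))
    obtain S | j := nerveObj c i
    · exact congrArg CylPt.face (Subtype.ext
        (Finset.image_image (s := S.1) (f := f.toOrderHom) (g := g.toOrderHom)).symm)
    · rfl

/-- The union of `Sd Δ[m]` and of the cylinder over the boundary of `Δ[m]`, as a subcomplex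
of the cylinder over `Δ[m]`. -/
def cylBase (m : SimplexCategory) : (nerve (CylPt m)).Subcomplex where
  obj k := {c | (∀ i, ∃ S, nerveObj c i = .face S) ∨
    ∃ x, ∀ i, x ∉ (nerveObj c i).supp}
  map f := by
    rintro c (h | ⟨x, hx⟩)
    · exact Or.inl fun i => h _
    · exact Or.inr ⟨x, fun i => hx _⟩

lemma anodyneExtensions_cylBase_ι (m : SimplexCategory) :
    anodyneExtensions (cylBase m).ι := by
  classical
  refine anodyneExtensions_of_toggle (cylBase m) CylPt.IsInterior (fun n s => ?_) (fun c hB => ?_)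
    CylPt.toggle CylPt.rank (fun c hc hB _ => ⟨?_, ?_, ?_⟩) (fun c hc hB _ => ⟨?_, ?_⟩)
    (fun c _ _ ht x hx hxt hx' ht' => CylPt.rank_erase_lt ht hx hxt (by convert hx')
      (by convert ht'))
  · show ¬ ((∀ i, ∃ S, nerveObj s i = .face S) ∨ ∃ x, ∀ i, x ∉ (nerveObj s i).supp) ↔ _
    rw [not_or, CylPt.IsInterior]
    refine and_congr ?_ ?_
    · push Not
      constructor
      · rintro ⟨i, hi⟩
        obtain ⟨S, hS⟩ | ⟨j, hj⟩ : (∃ S, nerveObj s i = .face S) ∨ ∃ j, nerveObj s i = .vert j := by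
          cases nerveObj s i <;> simp
        · exact (hi S hS).elim
        · exact ⟨j, (mem_nerveVertices _ _).2 ⟨i, hj⟩⟩
      · rintro ⟨j, hj⟩
        obtain ⟨i, hi⟩ := (mem_nerveVertices _ _).1 hj
        exact ⟨i, fun S hS => by simp [hi] at hS⟩
    · push Not
      rw [Finset.eq_univ_iff_forall]
      refine forall_congr' fun x => ?_
      simp [mem_nerveVertices]
  · obtain ⟨j, hj⟩ := hB.1
    exact ⟨_, hj⟩
  · convert CylPt.isChain_insert_toggle hc hB.1
  · obtain ⟨j, hj⟩ := hB.1
    refine ⟨⟨j, by simp [hj]⟩, Finset.eq_univ_of_forall fun x => ?_⟩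
    have hx := Finset.mem_univ x
    rw [← hB.2, Finset.mem_biUnion] at hx
    obtain ⟨a, ha, hx⟩ := hx
    exact Finset.mem_biUnion.2 ⟨a, by simp [ha], hx⟩
  · convert CylPt.toggle_congr CylPt.minVert_insert_toggle CylPt.lowFaces_insert_toggle
  · convert CylPt.isInterior_erase_toggle hB
  · convert CylPt.toggle_congr CylPt.minVert_erase_toggle CylPt.lowFaces_erase_toggle

open Opposite

/-- A support function on a cosimplicial simplicial set, attaching to any simplex of `F.obj m`
the set of vertices of the smallest face of `Δ[m]` it comes from. -/
structure Support (F : SimplexCategory ⥤ SSet.{0}) where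
  /-- the support of a simplex -/
  supp {m : SimplexCategory} {k : SimplexCategoryᵒᵖ} (c : (F.obj m).obj k) :
    Finset (Fin (m.len + 1))
  nonempty {m : SimplexCategory} {k : SimplexCategoryᵒᵖ} (c : (F.obj m).obj k) :
    (supp c).Nonempty
  supp_map {m n : SimplexCategory} (f : m ⟶ n) {k : SimplexCategoryᵒᵖ} (c : (F.obj m).obj k) :
    supp ((F.map f).app k c) = (supp c).image f.toOrderHom
  injective {m n : SimplexCategory} (f : m ⟶ n) (hf : Function.Injective f.toOrderHom)
    (k : SimplexCategoryᵒᵖ) : Function.Injective ((F.map f).app k)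
  exists_map {m n : SimplexCategory} (f : m ⟶ n) (hf : Function.Injective f.toOrderHom)
    {k : SimplexCategoryᵒᵖ} (c : (F.obj n).obj k)
    (hc : ∀ x ∈ supp c, ∃ y, f.toOrderHom y = x) : ∃ c', (F.map f).app k c' = c

/-- The right adjoint of the colimit-preserving extension of `F`. -/
def coExt (F : SimplexCategory ⥤ SSet.{0}) (Y : SSet.{0}) : SSet.{0} := F.op ⋙ yoneda.obj Y

section

variable {m n p : SimplexCategory}

lemma exists_comp_eq_of_injective {f : m ⟶ n} {g : p ⟶ n}
    (hg : Function.Injective g.toOrderHom)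
    (h : ∀ x, ∃ y, g.toOrderHom y = f.toOrderHom x) : ∃ q : m ⟶ p, q ≫ g = f := by
  choose q hq using h
  refine ⟨SimplexCategory.Hom.mk ⟨q, fun i j hij => ?_⟩, ?_⟩
  · have h := f.toOrderHom.monotone hij
    rw [← hq, ← hq] at h
    exact (g.toOrderHom.monotone.strictMono_of_injective hg).le_iff_le.1 h
  · ext x : 3
    exact hq x

lemma exists_comp_eq_of_injective' {f : m ⟶ n} {g : p ⟶ n}
    (hf : Function.Injective f.toOrderHom)
    (h : ∀ x, ∃ y, g.toOrderHom y = f.toOrderHom x) : ∃ q : m ⟶ p, q ≫ g = f := by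
  choose q hq using h
  refine ⟨SimplexCategory.Hom.mk ⟨q, fun i j hij => ?_⟩, ?_⟩
  · obtain rfl | hij := hij.eq_or_lt
    · rfl
    · have h := f.toOrderHom.monotone.strictMono_of_injective hf hij
      rw [← hq, ← hq] at h
      exact (g.toOrderHom.monotone.reflect_lt h).le
  · ext x : 3
    exact hq x

lemma exists_injective_range_eq (S : Finset (Fin (n.len + 1))) (hS : S.Nonempty) :
    ∃ (p : SimplexCategory) (r : p ⟶ n), Function.Injective r.toOrderHom ∧
      ∀ x, x ∈ S ↔ ∃ y, r.toOrderHom y = x := by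
  obtain ⟨k, hk⟩ : ∃ k, S.card = k + 1 := ⟨S.card - 1, by have := hS.card_pos; omega⟩
  refine ⟨SimplexCategory.mk k, SimplexCategory.Hom.mk (S.orderEmbOfFin hk).toOrderHom,
    (S.orderEmbOfFin hk).injective, fun x => ?_⟩
  rw [← Finset.mem_coe, ← Finset.range_orderEmbOfFin S hk]
  rfl

end

section

variable {F : SimplexCategory ⥤ SSet.{0}} {n : SimplexCategory}
  {A : (stdSimplex.{0}.obj n).Subcomplex} {Y : SSet.{0}}

variable (F A) in
/-- The image in `F.obj n` of the simplices of a subcomplex `A` of `Δ[n]`. -/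
def imageSubcomplex : (F.obj n).Subcomplex where
  obj k := {c | ∃ (m : SimplexCategory) (f : m ⟶ n)
    (_ : stdSimplex.objEquiv.symm f ∈ A.obj (op m)) (c' : (F.obj m).obj k),
      (F.map f).app k c' = c}
  map g := by
    rintro _ ⟨m, f, hf, c', rfl⟩
    exact ⟨m, f, hf, (F.obj m).map g c', NatTrans.naturality_apply (F.map f) g c'⟩

/-- The value of a map to `coExt F Y` on an element of `A`. -/
def evalHom (y : (A : SSet.{0}) ⟶ coExt F Y) {m : SimplexCategory} (f : m ⟶ n)
    (hf : stdSimplex.objEquiv.symm f ∈ A.obj (op m)) : F.obj m ⟶ Y :=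
  y.app (op m) ⟨stdSimplex.objEquiv.symm f, hf⟩

lemma evalHom_comp (y : (A : SSet.{0}) ⟶ coExt F Y) {m p : SimplexCategory} (g : p ⟶ m)
    (f : m ⟶ n) (hf : stdSimplex.objEquiv.symm f ∈ A.obj (op m))
    (hf' : stdSimplex.objEquiv.symm (g ≫ f) ∈ A.obj (op p)) :
    evalHom y (g ≫ f) hf' = F.map g ≫ evalHom y f hf :=
  NatTrans.naturality_apply y g.op ⟨stdSimplex.objEquiv.symm f, hf⟩

lemma comp_mem {m p : SimplexCategory} (g : p ⟶ m)
    (f : m ⟶ n) (hf : stdSimplex.objEquiv.symm f ∈ A.obj (op m)) :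
    stdSimplex.objEquiv.symm (g ≫ f) ∈ A.obj (op p) :=
  A.map g.op hf

namespace Support

variable (σ : Support F)
include σ

lemma exists_evalHom_eq (y : (A : SSet.{0}) ⟶ coExt F Y) {k : SimplexCategoryᵒᵖ}
    (c : (F.obj n).obj k) {p : SimplexCategory} (r : p ⟶ n)
    (hr : Function.Injective r.toOrderHom)
    (hr' : ∀ x, x ∈ σ.supp c ↔ ∃ y, r.toOrderHom y = x)
    {m : SimplexCategory} (f : m ⟶ n) (hf : stdSimplex.objEquiv.symm f ∈ A.obj (op m))
    (c' : (F.obj m).obj k) (hc' : (F.map f).app k c' = c) :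
    ∃ (h : stdSimplex.objEquiv.symm r ∈ A.obj (op p)) (d : (F.obj p).obj k),
      (F.map r).app k d = c ∧ (evalHom y f hf).app k c' = (evalHom y r h).app k d := by
  obtain ⟨q, f₁, hf₁, hf₁'⟩ := exists_injective_range_eq _ (σ.nonempty c')
  obtain ⟨d₁, rfl⟩ := σ.exists_map f₁ hf₁ c' (fun x hx => (hf₁' x).1 hx)
  subst hc'
  have hsupp := σ.supp_map f ((F.map f₁).app k d₁)
  obtain ⟨a, ha⟩ : ∃ a, a ≫ r = f₁ ≫ f := exists_comp_eq_of_injective hr fun x => by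
    rw [← hr', hsupp]
    exact Finset.mem_image_of_mem _ ((hf₁' _).2 ⟨x, rfl⟩)
  obtain ⟨z, rfl⟩ : ∃ z, z ≫ f = r := exists_comp_eq_of_injective' hr fun x => by
    have hx := (hr' _).2 ⟨x, rfl⟩
    rw [hsupp] at hx
    obtain ⟨y, -, hy⟩ := Finset.mem_image.1 hx
    exact ⟨y, hy⟩
  refine ⟨comp_mem z f hf, (F.map a).app k d₁, ?_, ?_⟩
  · have h := congr_arg (fun f => (F.map f).app k d₁) ha
    simp only [Functor.map_comp] at h ⊢
    exact h
  · have h₁ := congr_arg (fun f => f.app k d₁) (evalHom_comp y f₁ f hf (comp_mem f₁ f hf))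
    have h₂ := congr_arg (fun f => f.app k d₁) (evalHom_comp y a (z ≫ f) (comp_mem z f hf)
      (comp_mem a _ (comp_mem z f hf)))
    refine h₁.symm.trans (Eq.trans ?_ h₂)
    simp only [ha]

lemma evalHom_eq (y : (A : SSet.{0}) ⟶ coExt F Y) {k : SimplexCategoryᵒᵖ}
    {m : SimplexCategory} (f : m ⟶ n) (hf : stdSimplex.objEquiv.symm f ∈ A.obj (op m))
    {m' : SimplexCategory} (f' : m' ⟶ n) (hf' : stdSimplex.objEquiv.symm f' ∈ A.obj (op m'))
    (c : (F.obj m).obj k) (c' : (F.obj m').obj k)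
    (h : (F.map f).app k c = (F.map f').app k c') :
    (evalHom y f hf).app k c = (evalHom y f' hf').app k c' := by
  obtain ⟨p, r, hr, hr'⟩ := exists_injective_range_eq _ (σ.nonempty ((F.map f).app k c))
  obtain ⟨_, d, hd, hd'⟩ := σ.exists_evalHom_eq y _ r hr hr' f hf c rfl
  obtain ⟨_, e, he, he'⟩ := σ.exists_evalHom_eq y _ r hr hr' f' hf' c' h.symm
  rw [hd', he', σ.injective r hr k (hd.trans he.symm)]

/-- The universal property of `imageSubcomplex F A`. -/
lemma exists_desc (y : (A : SSet.{0}) ⟶ coExt F Y) :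
    ∃ g : (imageSubcomplex F A : SSet.{0}) ⟶ Y,
      ∀ {m : SimplexCategory} (f : m ⟶ n) (hf : stdSimplex.objEquiv.symm f ∈ A.obj (op m))
        {k : SimplexCategoryᵒᵖ} (c : (F.obj m).obj k)
        (hc : (F.map f).app k c ∈ (imageSubcomplex F A).obj k),
        g.app k ⟨(F.map f).app k c, hc⟩ = (evalHom y f hf).app k c := by
  choose m f hf c hc using fun (k : SimplexCategoryᵒᵖ) (x : (imageSubcomplex F A).obj k) => x.2
  refine ⟨{ app k := ↾fun x => (evalHom y (f k x) (hf k x)).app k (c k x)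
            naturality k l a := ?_ }, fun {m'} f' hf' k c' hc' => ?_⟩
  · apply ConcreteCategory.hom_ext
    intro x
    refine Eq.trans ?_ (NatTrans.naturality_apply (evalHom y (f k x) (hf k x)) a (c k x))
    refine σ.evalHom_eq y _ _ _ _ _ _ ?_
    refine (hc _ _).trans (Eq.trans ?_ (NatTrans.naturality_apply (F.map (f k x)) a (c k x)).symm)
    exact congrArg ((F.obj n).map a) (hc k x).symm
  · exact σ.evalHom_eq y _ _ _ _ _ _ (hc _ _)

end Support

end

lemma exists_nerve_preimage {P Q : Type} [PartialOrder P] [PartialOrder Q] (φ : P → Q)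
    (hφ : ∀ a b, φ a ≤ φ b → a ≤ b) {k : SimplexCategoryᵒᵖ} (c : (nerve Q).obj k)
    (hc : ∀ i, ∃ a, φ a = nerveObj c i) :
    ∃ c' : (nerve P).obj k, ∀ i, φ (nerveObj c' i) = nerveObj c i := by
  choose a ha using hc
  exact ⟨nerveMk a fun i j hij => hφ _ _ (by rw [ha, ha]; exact monotone_nerveObj c hij), ha⟩

lemma sdMap_reflect {m n : SimplexCategory} {f : m ⟶ n} (hf : Function.Injective f.toOrderHom)
    (S T : sd m) (h : sdMap f S ≤ sdMap f T) : S ≤ T :=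
  (Finset.image_subset_image_iff hf).1 h

lemma exists_sdMap_eq {m n : SimplexCategory} (f : m ⟶ n) (S : sd n)
    (hS : ∀ x ∈ S.1, ∃ y, f.toOrderHom y = x) : ∃ T, sdMap f T = S := by
  classical
  have h : (Finset.univ.filter fun y => f.toOrderHom y ∈ S.1).image f.toOrderHom = S.1 := by
    ext x
    simp only [Finset.mem_image, Finset.mem_filter, Finset.mem_univ, true_and]
    constructor
    · rintro ⟨y, hy, rfl⟩; exact hy
    · intro hx
      obtain ⟨y, rfl⟩ := hS x hx
      exact ⟨y, hx, rfl⟩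
  exact ⟨⟨_, Finset.image_nonempty.1 (h ▸ S.2)⟩, Subtype.ext h⟩

lemma CylPt.map_reflect {m n : SimplexCategory} {f : m ⟶ n}
    (hf : Function.Injective f.toOrderHom)
    (a b : CylPt m) (h : CylPt.map f a ≤ CylPt.map f b) : a ≤ b := by
  have hf' := f.toOrderHom.monotone.strictMono_of_injective hf
  obtain S | j := a <;> obtain T | k := b
  · exact face_le_face.2 (sdMap_reflect hf S T (face_le_face.1 h))
  · exact face_le_vert.2 fun x hx =>
      hf'.le_iff_le.1 (face_le_vert.1 h _ (Finset.mem_image_of_mem _ hx))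
  · exact (not_vert_le_face h).elim
  · exact vert_le_vert.2 (hf'.le_iff_le.1 (vert_le_vert.1 h))

/-- The support function for the barycentric subdivision. -/
def sdSupport : Support SdS where
  supp {m k} c := Finset.univ.biUnion fun i => (nerveObj (P := sd m) c i).1
  nonempty {m k} c := by
    obtain ⟨x, hx⟩ := (nerveObj (P := sd m) c 0).2
    exact ⟨x, Finset.mem_biUnion.2 ⟨0, Finset.mem_univ _, hx⟩⟩
  supp_map {m n} f {k} c := by
    rw [Finset.biUnion_image]
    rfl
  injective {m n} f hf k c c' h := by
    refine nerve_ext (P := sd m) fun i => ?_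
    have h : sdMap f (nerveObj (P := sd m) c i) = sdMap f (nerveObj (P := sd m) c' i) :=
      congrArg (fun c => nerveObj (P := sd n) c i) h
    exact le_antisymm (sdMap_reflect hf _ _ h.le) (sdMap_reflect hf _ _ h.ge)
  exists_map {m n} f hf k c hc := by
    obtain ⟨c', hc'⟩ := exists_nerve_preimage (sdMap f) (sdMap_reflect hf) c fun i =>
      exists_sdMap_eq f _ fun x hx => hc x (Finset.mem_biUnion.2 ⟨i, Finset.mem_univ _, hx⟩)
    exact ⟨c', nerve_ext (P := sd n) hc'⟩

/-- The support function for the cylinder. -/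
def cylSupport : Support CylS where
  supp {m k} c := Finset.univ.biUnion fun i => (nerveObj (P := CylPt m) c i).supp
  nonempty {m k} c := by
    obtain ⟨x, hx⟩ := (nerveObj (P := CylPt m) c 0).supp_nonempty
    exact ⟨x, Finset.mem_biUnion.2 ⟨0, Finset.mem_univ _, hx⟩⟩
  supp_map {m n} f {k} c := by
    rw [Finset.biUnion_image]
    refine Finset.biUnion_congr rfl fun i _ => ?_
    exact CylPt.supp_map f _
  injective {m n} f hf k c c' h := by
    refine nerve_ext (P := CylPt m) fun i => ?_
    have h : CylPt.map f (nerveObj (P := CylPt m) c i) =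
        CylPt.map f (nerveObj (P := CylPt m) c' i) :=
      congrArg (fun c => nerveObj (P := CylPt n) c i) h
    exact le_antisymm (CylPt.map_reflect hf _ _ h.le) (CylPt.map_reflect hf _ _ h.ge)
  exists_map {m n} f hf k c hc := by
    obtain ⟨c', hc'⟩ := exists_nerve_preimage (CylPt.map f) (CylPt.map_reflect hf) c fun i => by
      have hi (x) (hx : x ∈ (nerveObj (P := CylPt n) c i).supp) :=
        hc x (Finset.mem_biUnion.2 ⟨i, Finset.mem_univ _, hx⟩)
      generalize nerveObj (P := CylPt n) c i = a at hi
      obtain S | j := a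
      · obtain ⟨T, rfl⟩ := exists_sdMap_eq f S hi
        exact ⟨.face T, rfl⟩
      · obtain ⟨y, rfl⟩ := hi j (Finset.mem_singleton_self _)
        exact ⟨.vert y, rfl⟩
    exact ⟨c', nerve_ext (P := CylPt n) hc'⟩

lemma kanFibration_iff {X Y : SSet.{0}} (p : X ⟶ Y) :
    KanFibration p ↔ modelCategoryQuillen.J.rlp p := by
  constructor
  · intro h A B i hi
    simp only [modelCategoryQuillen.J, MorphismProperty.iSup_iff] at hi
    obtain ⟨n, ⟨i⟩⟩ := hi
    exact h n i
  · intro h n i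
    exact h _ (modelCategoryQuillen.horn_ι_mem_J (n + 1) i)

lemma hasLiftingProperty_of_anodyneExtensions {A B X Y : SSet.{0}} {i : A ⟶ B} {p : X ⟶ Y}
    (hi : anodyneExtensions i) (hp : KanFibration p) : HasLiftingProperty i p := by
  rw [anodyneExtensions_eq_llp_rlp] at hi
  exact hi _ ((kanFibration_iff p).1 hp)

/-- The inclusion of the barycentric subdivision in the cylinder. -/
def sdToCyl : SdS ⟶ CylS where
  app m := nerveMap (show Monotone (CylPt.face (m := m)) from
    fun _ _ h => CylPt.face_le_face.2 h).functor
  naturality _ _ _ := rfl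

lemma sdToCyl_injective (m : SimplexCategory) (k : SimplexCategoryᵒᵖ) :
    Function.Injective ((sdToCyl.app m).app k) := fun _ _ h =>
  nerve_ext (P := sd m) fun i =>
    CylPt.face.inj (congrArg (fun c => nerveObj (P := CylPt m) c i) h)

lemma exists_sdToCyl {m : SimplexCategory} {k : SimplexCategoryᵒᵖ} (c : (CylS.obj m).obj k)
    (hc : ∀ i, ∃ S, nerveObj (P := CylPt m) c i = .face S) :
    ∃ c', (sdToCyl.app m).app k c' = c := by
  obtain ⟨c', hc'⟩ := exists_nerve_preimage (CylPt.face (m := m))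
    (fun _ _ h => CylPt.face_le_face.1 h) c (fun i => (hc i).imp fun _ h => h.symm)
  exact ⟨c', nerve_ext (P := CylPt m) hc'⟩

/-- The functoriality of `coExt` in the simplicial set. -/
def coExtMap (F : SimplexCategory ⥤ SSet.{0}) {X Y : SSet.{0}} (p : X ⟶ Y) :
    coExt F X ⟶ coExt F Y :=
  Functor.whiskerLeft F.op (yoneda.map p)

/-- The functoriality of `coExt` in the cosimplicial object. -/
def coExtRes {F G : SimplexCategory ⥤ SSet.{0}} (τ : F ⟶ G) (X : SSet.{0}) :
    coExt G X ⟶ coExt F X :=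
  Functor.whiskerRight (NatTrans.op τ) (yoneda.obj X)

lemma coExtRes_naturality {F G : SimplexCategory ⥤ SSet.{0}} (τ : F ⟶ G) {X Y : SSet.{0}}
    (p : X ⟶ Y) : coExtRes τ X ≫ coExtMap F p = coExtMap G p ≫ coExtRes τ Y := rfl

lemma app_objEquiv_symm {F : SimplexCategory ⥤ SSet.{0}} {Y : SSet.{0}} {m n : SimplexCategory}
    (b : stdSimplex.obj n ⟶ coExt F Y) (f : m ⟶ n) :
    b.app (op m) (stdSimplex.objEquiv.symm f) = F.map f ≫ (yonedaEquiv b : F.obj n ⟶ Y) := by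
  refine Eq.trans ?_ (NatTrans.naturality_apply b f.op (stdSimplex.objEquiv.symm (𝟙 n)))
  congr 1
  rw [stdSimplex.map_objEquiv_symm]
  exact congrArg stdSimplex.objEquiv.symm (Category.comp_id f).symm

lemma exists_hom_of_rel {X Y : SSet.{0}} (R : ∀ k, X.obj k → Y.obj k → Prop)
    (h₁ : ∀ k x, ∃ y, R k x y) (h₂ : ∀ k x y y', R k x y → R k x y' → y = y')
    (h₃ : ∀ k l (f : k ⟶ l) x y, R k x y → R l (X.map f x) (Y.map f y)) :
    ∃ g : X ⟶ Y, ∀ k x, R k x (g.app k x) := by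
  choose g hg using h₁
  exact ⟨{ app k := ↾(g k)
           naturality k l f := ConcreteCategory.hom_ext _ _ fun x =>
            h₂ _ _ _ _ (hg _ _) (h₃ _ _ _ _ _ (hg _ _)) }, hg⟩

lemma exists_desc_of_cover {W₁ W₂ X Y : SSet.{0}} {w₁ : W₁ ⟶ X} {w₂ : W₂ ⟶ X}
    (hw : ∀ k x, (∃ a, w₁.app k a = x) ∨ (∃ a, w₂.app k a = x))
    (hw₁ : ∀ k, Function.Injective (w₁.app k)) (hw₂ : ∀ k, Function.Injective (w₂.app k))
    (u₁ : W₁ ⟶ Y) (u₂ : W₂ ⟶ Y)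
    (hu : ∀ k a b, w₁.app k a = w₂.app k b → u₁.app k a = u₂.app k b) :
    ∃ g : X ⟶ Y, w₁ ≫ g = u₁ ∧ w₂ ≫ g = u₂ := by
  let R (k) (x : X.obj k) (y : Y.obj k) : Prop :=
    (∃ a, w₁.app k a = x ∧ u₁.app k a = y) ∨ (∃ a, w₂.app k a = x ∧ u₂.app k a = y)
  have hR (k x y y') (h : R k x y) (h' : R k x y') : y = y' := by
    obtain ⟨a, ha, rfl⟩ | ⟨a, ha, rfl⟩ := h <;> obtain ⟨b, hb, rfl⟩ | ⟨b, hb, rfl⟩ := h'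
    · rw [hw₁ k (ha.trans hb.symm)]
    · exact hu _ _ _ (ha.trans hb.symm)
    · exact (hu _ _ _ (hb.trans ha.symm)).symm
    · rw [hw₂ k (ha.trans hb.symm)]
  obtain ⟨g, hg⟩ := exists_hom_of_rel R (fun k x => (hw k x).elim
      (fun ⟨a, ha⟩ => ⟨_, Or.inl ⟨a, ha, rfl⟩⟩) (fun ⟨a, ha⟩ => ⟨_, Or.inr ⟨a, ha, rfl⟩⟩)) hR
    (by
      rintro k l f x y (⟨a, rfl, rfl⟩ | ⟨a, rfl, rfl⟩)
      · exact Or.inl ⟨W₁.map f a, NatTrans.naturality_apply w₁ f a,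
          NatTrans.naturality_apply u₁ f a⟩
      · exact Or.inr ⟨W₂.map f a, NatTrans.naturality_apply w₂ f a,
          NatTrans.naturality_apply u₂ f a⟩)
  refine ⟨g, ?_, ?_⟩
  · apply NatTrans.ext
    funext k
    exact ConcreteCategory.hom_ext _ _ fun a => hR _ _ _ _ (hg _ _) (Or.inl ⟨a, rfl, rfl⟩)
  · apply NatTrans.ext
    funext k
    exact ConcreteCategory.hom_ext _ _ fun a => hR _ _ _ _ (hg _ _) (Or.inr ⟨a, rfl, rfl⟩)

section

open Simplicial

lemma imageSubcomplex_boundary_le (n : ℕ) :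
    imageSubcomplex CylS (boundary n) ≤ cylBase ⦋n⦌ := by
  rintro k _ ⟨m, f, hf, c, rfl⟩
  obtain ⟨x, hx⟩ := not_forall.1 hf
  refine Or.inr ⟨x, fun i hi => hx ?_⟩
  have hi : x ∈ (CylPt.map f (nerveObj (P := CylPt m) c i)).supp := hi
  rw [CylPt.supp_map] at hi
  obtain ⟨y, -, hy⟩ := Finset.mem_image.1 hi
  exact ⟨y, hy⟩

lemma mem_cylBase {n : ℕ} {k : SimplexCategoryᵒᵖ} {c : (nerve (CylPt ⦋n⦌)).obj k}
    (hc : c ∈ (cylBase ⦋n⦌).obj k) :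
    (∃ c', (sdToCyl.app ⦋n⦌).app k c' = c) ∨
      c ∈ (imageSubcomplex CylS (boundary n)).obj k := by
  obtain hc | ⟨x, hx⟩ := hc
  · exact Or.inl (exists_sdToCyl c hc)
  · right
    obtain ⟨p, r, hr, hr'⟩ := exists_injective_range_eq (n := ⦋n⦌) _ (cylSupport.nonempty c)
    obtain ⟨d, hd⟩ := cylSupport.exists_map r hr c fun x hx => (hr' x).1 hx
    refine ⟨p, r, fun h => ?_, d, hd⟩
    obtain ⟨i, -, hi⟩ := Finset.mem_biUnion.1 ((hr' x).2 (h x))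
    exact hx i hi

/-- The inclusion of `Sd Δ[n]` in `cylBase ⦋n⦌`. -/
def sdToCylBase (n : ℕ) : SdS.obj ⦋n⦌ ⟶ (cylBase ⦋n⦌ : SSet.{0}) where
  app k := ↾fun c => ⟨(sdToCyl.app ⦋n⦌).app k c, Or.inl fun _ => ⟨_, rfl⟩⟩
  naturality _ _ _ := rfl

theorem exists_lift_boundary {E B : SSet.{0}} {p : E ⟶ B} (hp : KanFibration p) (n : ℕ)
    (a : (boundary n : SSet.{0}) ⟶ coExt CylS E) (b : Δ[n] ⟶ coExt SdS E)
    (c : Δ[n] ⟶ coExt CylS B) (h₁ : a ≫ coExtRes sdToCyl E = (boundary n).ι ≫ b)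
    (h₂ : a ≫ coExtMap CylS p = (boundary n).ι ≫ c)
    (h₃ : b ≫ coExtMap SdS p = c ≫ coExtRes sdToCyl B) :
    ∃ l : Δ[n] ⟶ coExt CylS E, (boundary n).ι ≫ l = a ∧ l ≫ coExtRes sdToCyl E = b ∧
      l ≫ coExtMap CylS p = c := by
  let β : SdS.obj ⦋n⦌ ⟶ E := yonedaEquiv b
  let γ : CylS.obj ⦋n⦌ ⟶ B := yonedaEquiv c
  have hβγ : β ≫ p = sdToCyl.app ⦋n⦌ ≫ γ := congr_arg (fun f => yonedaEquiv f) h₃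
  have haβ {m : SimplexCategory} (f : m ⟶ ⦋n⦌)
      (hf : stdSimplex.objEquiv.symm f ∈ (boundary n).obj (op m)) :
      sdToCyl.app m ≫ evalHom a f hf = SdS.map f ≫ β := by
    rw [← app_objEquiv_symm]
    exact congr_arg (fun φ => φ.app (op m) ⟨stdSimplex.objEquiv.symm f, hf⟩) h₁
  have haγ {m : SimplexCategory} (f : m ⟶ ⦋n⦌)
      (hf : stdSimplex.objEquiv.symm f ∈ (boundary n).obj (op m)) :
      evalHom a f hf ≫ p = CylS.map f ≫ γ := by
    rw [← app_objEquiv_symm]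
    exact congr_arg (fun φ => φ.app (op m) ⟨stdSimplex.objEquiv.symm f, hf⟩) h₂
  obtain ⟨g, hg⟩ := cylSupport.exists_desc a
  let w : (imageSubcomplex CylS (boundary n) : SSet.{0}) ⟶ cylBase ⦋n⦌ :=
    Subcomplex.homOfLE (imageSubcomplex_boundary_le n)
  obtain ⟨t, ht₁, ht₂⟩ := exists_desc_of_cover (w₁ := sdToCylBase n) (w₂ := w)
    (by
      rintro k ⟨x, hx⟩
      refine (mem_cylBase hx).imp ?_ ?_
      · rintro ⟨y, rfl⟩
        exact ⟨y, rfl⟩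
      · intro hx
        exact ⟨⟨x, hx⟩, rfl⟩)
    (fun k x y h => sdToCyl_injective _ _ (congrArg Subtype.val h))
    (fun k x y h => Subtype.ext (congrArg (fun z => z.1) h)) β g
    (by
      rintro k x ⟨y, m, f, hf, z, rfl⟩ h
      have h : (sdToCyl.app ⦋n⦌).app k x = (CylS.map f).app k z := congrArg Subtype.val h
      refine Eq.trans ?_ (hg f hf z _).symm
      obtain ⟨z, rfl⟩ := exists_sdToCyl z (by
        intro i
        have hi : CylPt.face _ = CylPt.map f (nerveObj (P := CylPt m) z i) :=
          congrArg (fun c => nerveObj (P := CylPt ⦋n⦌) c i) h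
        cases hi' : nerveObj (P := CylPt m) z i with
        | face S => exact ⟨S, rfl⟩
        | vert j => simp [hi', CylPt.map] at hi)
      refine Eq.trans ?_ (congr_arg (fun φ => φ.app k z) (haβ f hf)).symm
      refine congrArg (β.app k) (sdToCyl_injective _ _ (h.trans ?_))
      exact (congr_arg (fun φ => φ.app k z) (sdToCyl.naturality f)).symm)
  have sq : CommSq t (cylBase ⦋n⦌).ι p γ := ⟨by
    apply NatTrans.ext
    funext k
    refine ConcreteCategory.hom_ext _ _ ?_
    rintro ⟨x, hx⟩
    obtain ⟨y, rfl⟩ | ⟨m, f, hf, z, rfl⟩ := mem_cylBase hx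
    · have h := congr_arg (fun φ => φ.app k y) ht₁
      exact (congrArg (p.app k) h).trans (congr_arg (fun φ => φ.app k y) hβγ)
    · have h := congr_arg (fun φ => φ.app k ⟨_, ⟨m, f, hf, z, rfl⟩⟩) ht₂
      exact (congrArg (p.app k) (h.trans (hg f hf z _))).trans
        (congr_arg (fun φ => φ.app k z) (haγ f hf))⟩
  have := hasLiftingProperty_of_anodyneExtensions (anodyneExtensions_cylBase_ι ⦋n⦌) hp
  obtain ⟨s, hs₁, hs₂⟩ : ∃ s : CylS.obj ⦋n⦌ ⟶ E, (cylBase ⦋n⦌).ι ≫ s = t ∧ s ≫ p = γ :=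
    have := this.sq_hasLift sq
    ⟨sq.lift, sq.fac_left, sq.fac_right⟩
  refine ⟨SSet.yonedaEquiv.symm s, ?_, ?_, ?_⟩
  · apply NatTrans.ext
    funext k
    refine ConcreteCategory.hom_ext _ _ ?_
    rintro ⟨f, hs⟩
    obtain ⟨f, rfl⟩ := stdSimplex.objEquiv.symm.surjective f
    show CylS.map f ≫ s = evalHom a f hs
    apply NatTrans.ext
    funext l
    refine ConcreteCategory.hom_ext _ _ fun z => ?_
    have h := congr_arg (fun φ => φ.app l ⟨_, ⟨_, f, hs, z, rfl⟩⟩) ht₂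
    refine Eq.trans ?_ (h.trans (hg f hs z _))
    exact congr_arg (fun φ => φ.app l ⟨_, imageSubcomplex_boundary_le n _ ⟨_, f, hs, z, rfl⟩⟩)
      hs₁
  · apply SSet.yonedaEquiv.injective
    have h := congr_arg (fun φ => sdToCylBase n ≫ φ) hs₁
    refine Eq.trans ?_ (h.trans ht₁)
    exact (SSet.yonedaEquiv_comp _ _).trans
      (congrArg ((coExtRes sdToCyl E).app (op ⦋n⦌))
        ((SSet.yonedaEquiv (X := coExt CylS E)).apply_symm_apply s))
  · apply SSet.yonedaEquiv.injective
    refine Eq.trans ?_ hs₂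
    exact (SSet.yonedaEquiv_comp _ _).trans
      (congrArg ((coExtMap CylS p).app (op ⦋n⦌))
        ((SSet.yonedaEquiv (X := coExt CylS E)).apply_symm_apply s))

end

theorem exists_lift_of_mono {E B : SSet.{0}} {p : E ⟶ B} (hp : KanFibration p)
    {X Z : SSet.{0}} (j : X ⟶ Z) [Mono j]
    (a : X ⟶ coExt CylS E) (b : Z ⟶ coExt SdS E)
    (c : Z ⟶ coExt CylS B) (h₁ : a ≫ coExtRes sdToCyl E = j ≫ b)
    (h₂ : a ≫ coExtMap CylS p = j ≫ c)
    (h₃ : b ≫ coExtMap SdS p = c ≫ coExtRes sdToCyl B) :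
    ∃ l : Z ⟶ coExt CylS E, j ≫ l = a ∧ l ≫ coExtRes sdToCyl E = b ∧
      l ≫ coExtMap CylS p = c := by
  let gap : coExt CylS E ⟶ pullback (coExtMap SdS p) (coExtRes sdToCyl B) :=
    pullback.lift (coExtRes sdToCyl E) (coExtMap CylS p) (coExtRes_naturality _ _)
  have gap_fst : gap ≫ pullback.fst _ _ = coExtRes sdToCyl E := pullback.lift_fst _ _ _
  have gap_snd : gap ≫ pullback.snd _ _ = coExtMap CylS p := pullback.lift_snd _ _ _
  clear_value gap
  have hgap : (MorphismProperty.monomorphisms SSet.{0}).rlp gap := by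
    rw [rlp_monomorphisms]
    rintro _ _ _ ⟨n⟩
    refine ⟨fun {a b} sq => ?_⟩
    obtain ⟨l, hl₁, hl₂, hl₃⟩ := exists_lift_boundary hp n a (b ≫ pullback.fst _ _)
      (b ≫ pullback.snd _ _)
      (by simpa [gap_fst] using sq.w =≫ pullback.fst _ _)
      (by simpa [gap_snd] using sq.w =≫ pullback.snd _ _)
      (by simp [pullback.condition])
    exact ⟨⟨{ l := l, fac_left := hl₁
              fac_right := by ext1 <;> simp [gap_fst, gap_snd, hl₂, hl₃] }⟩⟩
  have := hgap j (MorphismProperty.monomorphisms.infer_property j)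
  have sq : CommSq a j gap (pullback.lift b c h₃) := ⟨by
    ext1
    · rw [Category.assoc, Category.assoc, gap_fst, h₁]
      exact congrArg (j ≫ ·) (pullback.lift_fst _ _ _).symm
    · rw [Category.assoc, Category.assoc, gap_snd, h₂]
      exact congrArg (j ≫ ·) (pullback.lift_snd _ _ _).symm⟩
  refine ⟨sq.lift, sq.fac_left, ?_, ?_⟩
  · rw [← gap_fst, sq.fac_right_assoc]
    exact pullback.lift_fst _ _ _
  · rw [← gap_snd, sq.fac_right_assoc]
    exact pullback.lift_snd _ _ _

/-- The map of subdivisions induced by a monotone map. -/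
def sdHom {k m : SimplexCategory} (φ : sd k →o sd m) : SdS.obj k ⟶ SdS.obj m :=
  nerveMap φ.monotone.functor

/-- The monotone map sending a nonempty subset to the union of the sets indexed by it. -/
def sdBind {k m : SimplexCategory} (s : Fin (k.len + 1) → sd m) : sd k →o sd m where
  toFun T := ⟨T.1.biUnion fun t => (s t).1, T.2.biUnion fun t _ => (s t).2⟩
  monotone' _ _ h := Finset.biUnion_subset_biUnion_of_subset_left _ h

lemma map_sdHom_sdBind {l k m : SimplexCategory} (f : l ⟶ k) (s : Fin (k.len + 1) → sd m) :
    SdS.map f ≫ sdHom (sdBind s) = sdHom (sdBind fun i => s (f.toOrderHom i)) :=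
  congrArg sdHom (OrderHom.ext ((sdBind s).comp (sdMap f)) (sdBind fun i => s (f.toOrderHom i))
    (funext fun _ => Subtype.ext Finset.image_biUnion))

lemma sdHom_sdBind_map {k m n : SimplexCategory} (s : Fin (k.len + 1) → sd m) (f : m ⟶ n) :
    sdHom (sdBind s) ≫ SdS.map f = sdHom (sdBind fun i => sdMap f (s i)) :=
  congrArg sdHom (OrderHom.ext ((sdMap f).comp (sdBind s)) (sdBind fun i => sdMap f (s i))
    (funext fun _ => Subtype.ext Finset.biUnion_image))

/-- The map from a nerve to `Ex X` induced by an arbitrary function to `sd m` and a map from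
the subdivision of `Δ[m]` to `X`. -/
def nerveToEx {P : Type} [PartialOrder P] {m : SimplexCategory} {X : SSet.{0}} (s : P → sd m)
    (x : SdS.obj m ⟶ X) : nerve P ⟶ Ex.obj X where
  app k := ↾fun c => sdHom (k := k.unop) (sdBind fun i => s (nerveObj c i)) ≫ x
  naturality _ _ f := ConcreteCategory.hom_ext _ _ fun c =>
    congrArg (· ≫ x) (map_sdHom_sdBind f.unop fun i => s (nerveObj c i)).symm

lemma sdBind_eq_of_monotone {k m : SimplexCategory} (s : Fin (k.len + 1) → sd m)
    (hs : Monotone s) (T : sd k) : sdBind s T = s (T.1.max' T.2) := by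
  apply le_antisymm
  · exact Finset.biUnion_subset.2 fun t ht => hs (Finset.le_max' _ _ ht)
  · exact Finset.subset_biUnion_of_mem (fun t => (s t).1) (Finset.max'_mem _ _)

lemma max_sdBind {k m : SimplexCategory} (s : Fin (k.len + 1) → sd m)
    (hs : Monotone fun t => (s t).1.max' (s t).2) (T : sd k) :
    (sdBind s T).1.max' (sdBind s T).2 = (s (T.1.max' T.2)).1.max' (s (T.1.max' T.2)).2 := by
  apply le_antisymm
  · refine Finset.max'_le _ (sdBind s T).2 _ fun y hy => ?_
    obtain ⟨t, ht, hy⟩ := Finset.mem_biUnion.1 hy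
    exact (Finset.le_max' _ _ hy).trans (hs (Finset.le_max' _ _ ht))
  · exact Finset.le_max' _ _ (Finset.mem_biUnion.2
      ⟨_, Finset.max'_mem T.1 _, Finset.max'_mem (s _).1 _⟩)

lemma nerveToEx_id {m : SimplexCategory} {X : SSet.{0}} (x : SdS.obj m ⟶ X) :
    nerveToEx (P := sd m) id x = x ≫ nu X := by
  apply NatTrans.ext
  funext k
  refine ConcreteCategory.hom_ext _ _ fun c => ?_
  apply NatTrans.ext
  funext l
  refine ConcreteCategory.hom_ext _ _ fun d => ?_
  refine Eq.trans ?_ (NatTrans.naturality_apply x (maxChain d).op c)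
  refine congrArg (x.app l) (nerve_ext (P := sd m) fun i => ?_)
  exact sdBind_eq_of_monotone _ (monotone_nerveObj (P := sd m) c) _

/-- The support of a point of the cylinder. -/
def CylPt.suppSd {m : SimplexCategory} (a : CylPt m) : sd m := ⟨a.supp, a.supp_nonempty⟩

/-- The map to `Ex X` from the cylinder associated to a simplex of `Ex X`. -/
def exToCyl (X : SSet.{0}) : Ex.obj X ⟶ coExt CylS (Ex.obj X) where
  app m := ↾fun x => nerveToEx (P := CylPt m.unop) CylPt.suppSd x
  naturality m n f := by
    refine ConcreteCategory.hom_ext _ _ fun x => ?_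
    apply NatTrans.ext
    funext k
    refine ConcreteCategory.hom_ext _ _ fun c => ?_
    refine congrArg (· ≫ x) ((sdHom_sdBind_map _ f.unop).trans ?_)
    exact congrArg (fun s => sdHom (sdBind s)) (funext fun i =>
      Subtype.ext (CylPt.supp_map f.unop (nerveObj (P := CylPt n.unop) c i)).symm)

lemma exToCyl_coExtRes (X : SSet.{0}) :
    exToCyl X ≫ coExtRes sdToCyl (Ex.obj X) = Ex.map (nu X) := by
  apply NatTrans.ext
  funext m
  exact ConcreteCategory.hom_ext _ _ fun x => nerveToEx_id x

/-- The projection of the cylinder to its base. -/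
def CylPt.max {m : SimplexCategory} : CylPt m →o Fin (m.len + 1) where
  toFun a := a.supp.max' a.supp_nonempty
  monotone' := by
    rintro (S | j) (T | k) h
    · exact Finset.max'_subset _ (face_le_face.1 h)
    · exact Finset.max'_le _ _ _ fun x hx =>
        (face_le_vert.1 h x hx).trans (Finset.le_max' _ _ (Finset.mem_singleton_self k))
    · exact (not_vert_le_face h).elim
    · exact Finset.max'_le _ _ _ fun x hx => by
        rw [Finset.mem_singleton.1 hx]
        exact (vert_le_vert.1 h).trans (Finset.le_max' _ _ (Finset.mem_singleton_self k))

lemma CylPt.max_map {m n : SimplexCategory} (f : m ⟶ n) (a : CylPt m) :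
    CylPt.max (CylPt.map f a) = f.toOrderHom (CylPt.max a) := by
  apply le_antisymm
  · refine Finset.max'_le _ (supp_nonempty _) _ fun x hx => ?_
    rw [supp_map] at hx
    obtain ⟨y, hy, rfl⟩ := Finset.mem_image.1 hx
    exact f.toOrderHom.monotone (Finset.le_max' _ _ hy)
  · refine Finset.le_max' _ _ ?_
    rw [supp_map]
    exact Finset.mem_image_of_mem _ (Finset.max'_mem _ a.supp_nonempty)

/-- The operator induced by a chain of the cylinder. -/
def cylMaxChain {m : SimplexCategory} {k : SimplexCategoryᵒᵖ} (c : (CylS.obj m).obj k) :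
    k.unop ⟶ m :=
  SimplexCategory.Hom.mk
    (CylPt.max.comp ⟨nerveObj (P := CylPt m) c, monotone_nerveObj (P := CylPt m) c⟩)

/-- The map to `coExt CylS X` induced by the projection of the cylinder to its base. -/
def cylNu (X : SSet.{0}) : X ⟶ coExt CylS X where
  app m := ↾fun x =>
    { app k := ↾fun c => X.map (cylMaxChain c).op x
      naturality k l f := ConcreteCategory.hom_ext _ _ fun c =>
        congrArg (fun g => g x) (X.map_comp (cylMaxChain c).op f) }
  naturality m n f := by
    refine ConcreteCategory.hom_ext _ _ fun x => ?_
    apply NatTrans.ext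
    funext k
    refine ConcreteCategory.hom_ext _ _ fun c => ?_
    refine (congrArg (fun g => g x) (X.map_comp f (cylMaxChain c).op)).symm.trans ?_
    refine congrArg (fun g => X.map g x) (Quiver.Hom.unop_inj ?_)
    ext i : 3
    exact (CylPt.max_map f.unop (nerveObj (P := CylPt n.unop) c i)).symm

lemma nu_exToCyl (X : SSet.{0}) : nu X ≫ exToCyl X = cylNu X ≫ coExtMap CylS (nu X) := by
  apply NatTrans.ext
  funext m
  refine ConcreteCategory.hom_ext _ _ fun x => ?_
  apply NatTrans.ext
  funext k
  refine ConcreteCategory.hom_ext _ _ fun c => ?_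
  apply NatTrans.ext
  funext l
  refine ConcreteCategory.hom_ext _ _ fun d => ?_
  refine Eq.trans ?_ (congrArg (fun g => g x) (X.map_comp (cylMaxChain c).op (maxChain d).op))
  refine congrArg (fun g => X.map g x) (Quiver.Hom.unop_inj ?_)
  ext i : 3
  exact max_sdBind _ (CylPt.max.monotone.comp (monotone_nerveObj (P := CylPt m.unop) c))
    (nerveObj (P := sd k.unop) d i)

/-- The chain of all the points in the base of the cylinder. -/
def vertChain (m : SimplexCategory) : (CylS.obj m).obj (op m) :=
  nerveMk (P := CylPt m) (m := op m) CylPt.vert fun _ _ h => CylPt.vert_le_vert.2 h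

/-- The restriction to the base of the cylinder. -/
def evalVert (E : SSet.{0}) : coExt CylS E ⟶ E where
  app m := ↾fun y => NatTrans.app (F := CylS.obj m.unop) y m (vertChain m.unop)
  naturality m _ f := ConcreteCategory.hom_ext _ _ fun y =>
    NatTrans.naturality_apply (F := CylS.obj m.unop) y f (vertChain m.unop)

lemma cylNu_evalVert (X : SSet.{0}) : cylNu X ≫ evalVert X = 𝟙 X := by
  apply NatTrans.ext
  funext m
  refine ConcreteCategory.hom_ext _ _ fun x => ?_
  exact congrArg (fun g => g x) (X.map_id m)

lemma exToCyl_evalVert (X : SSet.{0}) : exToCyl X ≫ evalVert (Ex.obj X) = 𝟙 _ := by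
  apply NatTrans.ext
  funext m
  refine ConcreteCategory.hom_ext _ _ fun x => ?_
  refine Eq.trans (congrArg (· ≫ x) (?_ : sdHom _ = 𝟙 (SdS.obj m.unop))) (Category.id_comp _)
  refine (congrArg sdHom (OrderHom.ext _ OrderHom.id ?_)).trans rfl
  exact funext fun T => Subtype.ext Finset.biUnion_singleton_eq_self

instance mono_nu (X : SSet.{0}) : Mono (nu X) := by
  let t (m : SimplexCategory) : (SdS.obj m).obj (op m) :=
    nerveMk (P := sd m) (m := op m) (fun i => ⟨Finset.Iic i, i, Finset.mem_Iic.2 le_rfl⟩)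
      fun _ _ h => Finset.Iic_subset_Iic.2 h
  have ht (m) : maxChain (t m) = 𝟙 m := by
    ext i : 3
    apply le_antisymm
    · exact Finset.max'_le _ ⟨i, Finset.mem_Iic.2 le_rfl⟩ _ fun y hy => Finset.mem_Iic.1 hy
    · exact Finset.le_max' _ _ (Finset.mem_Iic.2 le_rfl)
  rw [NatTrans.mono_iff_mono_app]
  intro m
  rw [mono_iff_injective]
  intro x y h
  have h := congrArg (fun z => NatTrans.app (F := SdS.obj m.unop) z m (t m.unop)) h
  have h' (x : X.obj m) : X.map (maxChain (t m.unop)).op x = x := by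
    rw [ht]
    exact congrArg (fun g => g x) (X.map_id m)
  exact (h' x).symm.trans (Eq.trans h (h' y))

theorem anodyne_nu (X : SSet.{0}) : Anodyne (nu X) := by
  intro E B p hp
  refine ⟨fun {u v} sq => ?_⟩
  obtain ⟨l, hl₁, -, hl₂⟩ := exists_lift_of_mono hp (nu X) (cylNu X ≫ coExtMap CylS u)
    (Ex.map u) (exToCyl X ≫ coExtMap CylS v) rfl
    (by
      have h : coExtMap CylS (u ≫ p) = coExtMap CylS (nu X ≫ v) := by rw [sq.w]
      refine (congrArg (cylNu X ≫ ·) h).trans ?_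
      exact congrArg (· ≫ coExtMap CylS v) (nu_exToCyl X).symm)
    (by
      have h : Ex.map (u ≫ p) = Ex.map (nu X ≫ v) := by rw [sq.w]
      refine Eq.trans h ?_
      exact congrArg (· ≫ coExtMap SdS v) (exToCyl_coExtRes X).symm)
  refine ⟨⟨{ l := l ≫ evalVert E, fac_left := ?_, fac_right := ?_ }⟩⟩
  · refine (congrArg (· ≫ evalVert E) hl₁).trans ?_
    exact (congrArg (· ≫ u) (cylNu_evalVert X)).trans (Category.id_comp u)
  · refine (congrArg (· ≫ evalVert B) hl₂).trans ?_
    exact (congrArg (· ≫ v) (exToCyl_evalVert X)).trans (Category.id_comp v)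

lemma anodyneExtensions_of_anodyne {A B : SSet.{0}} {i : A ⟶ B} (hi : Anodyne i) :
    anodyneExtensions i := by
  rw [anodyneExtensions_eq_llp_rlp]
  exact fun _ _ p hp => hi p ((kanFibration_iff p).2 hp)

theorem anodyne_nuInfty (X : SSet.{0}) : Anodyne (nuInfty X) := by
  intro E B p hp
  refine HasLiftingProperty.transfiniteComposition.hasLiftingProperty_ι_app_bot
    (F := ExInftyDiagram X) (colimit.isColimit _) fun j _ => ?_
  have h := anodyne_nu (ExIter X j) p hp
  rw [← Functor.ofSequence_map_homOfLE_succ (fun n => nu (ExIter X n)) j] at h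
  exact h

lemma ept_fst (X : SSet.{0}) (k : Fin 2) :
    ept X k ≫ CartesianMonoidalCategory.fst _ _ = 𝟙 X :=
  CartesianMonoidalCategory.lift_fst _ _

lemma ept_snd (X : SSet.{0}) (k : Fin 2) :
    ept X k ≫ CartesianMonoidalCategory.snd _ _ = cst X k :=
  CartesianMonoidalCategory.lift_snd _ _

lemma ept_injective (X : SSet.{0}) (k : Fin 2) (m : SimplexCategoryᵒᵖ) :
    Function.Injective ((ept X k).app m) := fun a b h => by
  have h' (a : X.obj m) : (CartesianMonoidalCategory.fst X _).app m ((ept X k).app m a) = a :=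
    congrArg (fun φ : X ⟶ X => φ.app m a) (ept_fst X k)
  exact (h' a).symm.trans ((congrArg _ h).trans (h' b))

lemma ept_ne (X : SSet.{0}) (m : SimplexCategoryᵒᵖ) (a b : X.obj m) :
    (ept X 0).app m a ≠ (ept X 1).app m b := fun h => by
  have h' (k : Fin 2) (a : X.obj m) :
      (CartesianMonoidalCategory.snd X _).app m ((ept X k).app m a) = (cst X k).app m a :=
    congrArg (fun φ : X ⟶ _ => φ.app m a) (ept_snd X k)
  have h : (cst X 0).app m a = (cst X 1).app m b :=
    (h' 0 a).symm.trans ((congrArg _ h).trans (h' 1 b))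
  exact zero_ne_one (congrArg (fun s => stdSimplex.asOrderHom s 0) h)

/-- The union of the two ends of the cylinder `X ⊗ Δ[1]`. -/
def ends (X : SSet.{0}) : Subcomplex (X ⊗ stdSimplex.obj (SimplexCategory.mk 1)) where
  obj m := {x | (∃ a, (ept X 0).app m a = x) ∨ (∃ a, (ept X 1).app m a = x)}
  map f := by
    rintro _ (⟨a, rfl⟩ | ⟨a, rfl⟩)
    · exact Or.inl ⟨_, NatTrans.naturality_apply (ept X 0) f a⟩
    · exact Or.inr ⟨_, NatTrans.naturality_apply (ept X 1) f a⟩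

/-- The inclusion of the two copies of `X` in the ends of the cylinder `X ⊗ Δ[1]`. -/
noncomputable def toEnds (X : SSet.{0}) (k : Fin 2) : X ⟶ ends X where
  app m := ↾fun a => ⟨(ept X k).app m a, by
    obtain rfl | rfl : k = 0 ∨ k = 1 := by lia
    · exact Or.inl ⟨a, rfl⟩
    · exact Or.inr ⟨a, rfl⟩⟩
  naturality _ _ f := ConcreteCategory.hom_ext _ _ fun a =>
    Subtype.ext (NatTrans.naturality_apply (ept X k) f a)

lemma toEnds_ι (X : SSet.{0}) (k : Fin 2) : toEnds X k ≫ (ends X).ι = ept X k := rfl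

lemma exists_toEnds {X : SSet.{0}} (m : SimplexCategoryᵒᵖ) (x : (ends X : SSet.{0}).obj m) :
    (∃ a, (toEnds X 0).app m a = x) ∨ (∃ a, (toEnds X 1).app m a = x) := by
  obtain ⟨_, ⟨a, rfl⟩ | ⟨a, rfl⟩⟩ := x
  · exact Or.inl ⟨a, rfl⟩
  · exact Or.inr ⟨a, rfl⟩

lemma toEnds_injective (X : SSet.{0}) (k : Fin 2) (m : SimplexCategoryᵒᵖ) :
    Function.Injective ((toEnds X k).app m) := fun _ _ h =>
  ept_injective X k m (congrArg (fun z => z.1) h)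

lemma exists_desc_ends {X Y : SSet.{0}} (f g : X ⟶ Y) :
    ∃ h : (ends X : SSet.{0}) ⟶ Y, toEnds X 0 ≫ h = f ∧ toEnds X 1 ≫ h = g :=
  exists_desc_of_cover exists_toEnds (toEnds_injective X 0) (toEnds_injective X 1) f g
    fun k a b h => (ept_ne X k a b (congrArg (fun z => z.1) h)).elim

lemma ends_hom_ext {X Y : SSet.{0}} {f g : (ends X : SSet.{0}) ⟶ Y}
    (h₀ : toEnds X 0 ≫ f = toEnds X 0 ≫ g) (h₁ : toEnds X 1 ≫ f = toEnds X 1 ≫ g) : f = g := by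
  apply NatTrans.ext
  funext k
  refine ConcreteCategory.hom_ext _ _ fun x => ?_
  obtain ⟨a, rfl⟩ | ⟨a, rfl⟩ := exists_toEnds k x
  · exact congrArg (fun φ : X ⟶ Y => φ.app k a) h₀
  · exact congrArg (fun φ : X ⟶ Y => φ.app k a) h₁

theorem TrivialFibration.homotopyEquivalence {E B : SSet.{0}} {p : E ⟶ B}
    (hp : TrivialFibration p) : HomotopyEquivalence p := by
  have hp : (MorphismProperty.monomorphisms SSet.{0}).rlp p := by
    rw [rlp_monomorphisms]
    rintro _ _ _ ⟨n⟩
    exact hp n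
  obtain ⟨g, hg⟩ : ∃ g : B ⟶ E, g ≫ p = 𝟙 B := by
    have := hp (initial.to B) (MorphismProperty.monomorphisms.infer_property _)
    have sq : CommSq (initial.to E) (initial.to B) p (𝟙 B) := ⟨initialIsInitial.hom_ext _ _⟩
    exact ⟨sq.lift, sq.fac_right⟩
  obtain ⟨h, h₀, h₁⟩ := exists_desc_ends (p ≫ g) (𝟙 E)
  have := hp (ends E).ι (MorphismProperty.monomorphisms.infer_property _)
  have hfst (k : Fin 2) : toEnds E k ≫ (ends E).ι ≫ CartesianMonoidalCategory.fst _ _ ≫ p = p := by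
    rw [← Category.assoc, toEnds_ι, ← Category.assoc, ept_fst, Category.id_comp]
  have sq : CommSq h (ends E).ι p (CartesianMonoidalCategory.fst _ _ ≫ p) := ⟨ends_hom_ext
    (by rw [hfst, ← Category.assoc, h₀, Category.assoc, hg, Category.comp_id])
    (by rw [hfst, ← Category.assoc, h₁, Category.id_comp])⟩
  refine ⟨g, .rel _ _ ⟨sq.lift, ?_, ?_⟩, ?_⟩
  · rw [← toEnds_ι, Category.assoc, sq.fac_left, h₀]
  · rw [← toEnds_ι, Category.assoc, sq.fac_left, h₁]
  · rw [hg]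
    exact .refl _

/-- The simplicial set `Δ[0]` is terminal. -/
def isTerminalPt : IsTerminal (stdSimplex.{0}.obj (SimplexCategory.mk 0)) :=
  IsTerminal.ofUniqueHom toPt fun X f => by
    apply NatTrans.ext
    funext m
    refine ConcreteCategory.hom_ext _ _ fun x => ?_
    apply stdSimplex.objEquiv.injective
    ext i : 3
    exact @Subsingleton.elim (Fin 1) _ _ _

theorem trivialFibration_pre {A B : SSet.{0}} {i : A ⟶ B} (hi : Anodyne i) {K : SSet.{0}}
    (hK : KanComplex K) : TrivialFibration ((MonoidalClosed.pre i).app K) := by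
  intro n
  let sq₁₂ := Functor.PushoutObjObj.ofHasPushout (curriedTensor SSet.{0}) i (boundary n).ι
  let sq₁₃ := Functor.PullbackObjObj.ofIsTerminal MonoidalClosed.internalHom i (toPt K)
    isTerminalPt
  refine (MonoidalClosed.internalHomAdjunction₂.hasLiftingProperty_iff sq₁₂ sq₁₃).1 ?_
  exact hasLiftingProperty_of_anodyneExtensions
    (anodyneExtensions_pushoutObjObjι' sq₁₂ (anodyneExtensions_of_anodyne hi)) hK

theorem Anodyne.weakHomotopyEquivalence {A B : SSet.{0}} {i : A ⟶ B} (hi : Anodyne i) :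
    WeakHomotopyEquivalence i :=
  fun _ hK => (trivialFibration_pre hi hK).homotopyEquivalence

section

open Simplicial

variable {n : ℕ} (i : Fin (n + 1))

open scoped Classical in
/-- The maximum of a face of the horn `Λ[n, i]`, and `i` for the other faces of `Δ[n]`. -/
noncomputable def hornMax (S : sd ⦋n⦌) : Fin (n + 1) :=
  if ∃ j, j ≠ i ∧ j ∉ S.1 then S.1.max' S.2 else i

lemma hornMax_of_notMem {S : sd ⦋n⦌} {j : Fin (n + 1)} (hj : j ≠ i) (hS : j ∉ S.1) :
    hornMax i S = S.1.max' S.2 :=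
  if_pos ⟨j, hj, hS⟩

lemma exists_forall_hornMax_ne (hn : 0 < n) {k : ℕ} (c : Fin (k + 1) → sd ⦋n⦌)
    (hc : Monotone c) : ∃ j, j ≠ i ∧ ∀ t, hornMax i (c t) ≠ j := by
  classical
  let A : Finset (Fin (k + 1)) := Finset.univ.filter fun t => ∃ j, j ≠ i ∧ j ∉ (c t).1
  have hA {t} (ht : t ∉ A) : hornMax i (c t) = i := if_neg fun h => ht (by simpa [A] using h)
  obtain hA' | hA' := A.eq_empty_or_nonempty
  · have : Nontrivial (Fin (n + 1)) := Fin.nontrivial_iff_two_le.2 (by omega)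
    obtain ⟨j, hj⟩ := exists_ne i
    exact ⟨j, hj, fun t => by rw [hA (by simp [hA'])]; exact hj.symm⟩
  · obtain ⟨j, hj, hj'⟩ := (Finset.mem_filter.1 (A.max'_mem hA')).2
    refine ⟨j, hj, fun t => ?_⟩
    by_cases ht : t ∈ A
    · have h : j ∉ (c t).1 := fun h => hj' (hc (A.le_max' t ht) h)
      rw [hornMax_of_notMem i hj h]
      exact fun h' => h (h' ▸ Finset.max'_mem _ _)
    · rw [hA ht]
      exact hj.symm

/-- The singleton of the value of `hornMax`. -/
noncomputable def hornMaxSd (S : sd ⦋n⦌) : sd ⦋n⦌ := ⟨{hornMax i S}, Finset.singleton_nonempty _⟩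

lemma objEquiv_symm_mem_horn_iff {m : SimplexCategory} (f : m ⟶ ⦋n⦌) :
    stdSimplex.objEquiv.symm f ∈ (horn.{0} n i).obj (op m) ↔
      ∃ j, j ≠ i ∧ ∀ x, f.toOrderHom x ≠ j := by
  rw [mem_horn_iff, Set.ne_univ_iff_exists_notMem]
  refine exists_congr fun j => ?_
  rw [Set.mem_union, not_or, and_comm]
  exact and_congr Iff.rfl not_exists

lemma hornMax_sdMap {m : SimplexCategory} {f : m ⟶ ⦋n⦌}
    (hf : stdSimplex.objEquiv.symm f ∈ (horn.{0} n i).obj (op m)) (S : sd m) :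
    hornMax i (sdMap f S) = f.toOrderHom (S.1.max' S.2) := by
  obtain ⟨j, hj, hf⟩ := (objEquiv_symm_mem_horn_iff i f).1 hf
  refine (hornMax_of_notMem i hj fun h => ?_).trans
    (Finset.max'_image f.toOrderHom.monotone S.1 (sdMap f S).2)
  obtain ⟨x, -, hx⟩ := Finset.mem_image.1 h
  exact hf x hx

lemma mem_imageSubcomplex_horn {k : SimplexCategoryᵒᵖ} (c : (SdS.obj ⦋n⦌).obj k)
    (hc : ∃ j, j ≠ i ∧ ∀ t, j ∉ (nerveObj (P := sd ⦋n⦌) c t).1) :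
    c ∈ (imageSubcomplex SdS (horn n i)).obj k := by
  obtain ⟨j, hj, hc⟩ := hc
  obtain ⟨p, r, hr, hr'⟩ := exists_injective_range_eq (n := ⦋n⦌) _ (sdSupport.nonempty c)
  obtain ⟨d, hd⟩ := sdSupport.exists_map r hr c fun x hx => (hr' x).1 hx
  refine ⟨p, r, (objEquiv_symm_mem_horn_iff i r).2 ⟨j, hj, fun x hx => ?_⟩, d, hd⟩
  obtain ⟨t, -, ht⟩ := Finset.mem_biUnion.1 ((hr' j).2 ⟨x, hx⟩)
  exact hc t ht

lemma sdHom_hornMaxSd_mem (hn : 0 < n) {k : SimplexCategoryᵒᵖ} (c : (SdS.obj ⦋n⦌).obj k)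
    {l : SimplexCategoryᵒᵖ} (d : (SdS.obj k.unop).obj l) :
    (sdHom (sdBind fun t => hornMaxSd i (nerveObj (P := sd ⦋n⦌) c t))).app l d ∈
      (imageSubcomplex SdS (horn n i)).obj l := by
  obtain ⟨j, hj, hc⟩ := exists_forall_hornMax_ne i hn _ (monotone_nerveObj (P := sd ⦋n⦌) c)
  refine mem_imageSubcomplex_horn i _ ⟨j, hj, fun t ht => ?_⟩
  obtain ⟨s, -, hs⟩ := Finset.mem_biUnion.1 ht
  exact hc s (Finset.mem_singleton.1 hs).symm

/-- The map `Sd Δ[k] ⟶ Sd Λ[n, i]` induced by a simplex of `Sd Δ[n]` and `hornMax`. -/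
noncomputable def hornMaxHom (hn : 0 < n) {k : SimplexCategoryᵒᵖ} (c : (SdS.obj ⦋n⦌).obj k) :
    SdS.obj k.unop ⟶ (imageSubcomplex SdS (horn n i) : SSet.{0}) where
  app _ := ↾fun d => ⟨_, sdHom_hornMaxSd_mem i hn c d⟩
  naturality _ _ _ := rfl

lemma hornMaxHom_map (hn : 0 < n) {k l : SimplexCategoryᵒᵖ} (f : k ⟶ l)
    (c : (SdS.obj ⦋n⦌).obj k) :
    hornMaxHom i hn ((SdS.obj ⦋n⦌).map f c) = SdS.map f.unop ≫ hornMaxHom i hn c := by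
  apply NatTrans.ext
  funext q
  refine ConcreteCategory.hom_ext _ _ fun d => Subtype.ext ?_
  exact (congrArg (fun φ : SdS.obj l.unop ⟶ SdS.obj ⦋n⦌ => φ.app q d)
    (map_sdHom_sdBind f.unop fun t => hornMaxSd i (nerveObj (P := sd ⦋n⦌) c t))).symm

/-- The simplex of `Ex (Ex Y)` induced by a map `Sd Λ[n, i] ⟶ Y`. -/
noncomputable def hornFiller (hn : 0 < n) {Y : SSet.{0}}
    (h : (imageSubcomplex SdS (horn n i) : SSet.{0}) ⟶ Y) : SdS.obj ⦋n⦌ ⟶ Ex.obj Y where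
  app _ := ↾fun c => hornMaxHom i hn c ≫ h
  naturality _ _ f := ConcreteCategory.hom_ext _ _ fun c =>
    congrArg (· ≫ h) (hornMaxHom_map i hn f c)

theorem exists_extension_nu (hn : 0 < n) {Y : SSet.{0}} (y : (horn n i : SSet.{0}) ⟶ Ex.obj Y) :
    ∃ z : stdSimplex.obj ⦋n⦌ ⟶ Ex.obj (Ex.obj Y), (horn n i).ι ≫ z = y ≫ nu (Ex.obj Y) := by
  obtain ⟨h, hh⟩ := sdSupport.exists_desc (F := SdS) (A := horn n i) (Y := Y) y
  refine ⟨(SSet.yonedaEquiv (X := Ex.obj (Ex.obj Y))).symm (hornFiller i hn h), ?_⟩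
  apply NatTrans.ext
  funext m
  refine ConcreteCategory.hom_ext _ _ fun a => ?_
  obtain ⟨a, ha⟩ := a
  obtain ⟨f, rfl⟩ := stdSimplex.objEquiv.symm.surjective a
  refine (app_objEquiv_symm (F := SdS) (Y := Ex.obj Y)
    ((SSet.yonedaEquiv (X := Ex.obj (Ex.obj Y))).symm (hornFiller i hn h)) f).trans ?_
  refine (congrArg (SdS.map f ≫ ·)
    (Equiv.apply_symm_apply (SSet.yonedaEquiv (X := Ex.obj (Ex.obj Y))) _)).trans ?_
  apply NatTrans.ext
  funext k
  refine ConcreteCategory.hom_ext _ _ fun c => ?_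
  have hc := comp_mem (maxChain c) f ha
  have key : sdHom (sdBind fun t => hornMaxSd i (sdMap f (nerveObj (P := sd m.unop) c t))) =
      SdS.map (maxChain c ≫ f) := by
    refine congrArg sdHom (OrderHom.ext _ (sdMap (maxChain c ≫ f)) (funext fun T =>
      Subtype.ext (Finset.biUnion_singleton.trans (Finset.image_congr fun t _ => ?_))))
    exact hornMax_sdMap i ha _
  apply NatTrans.ext
  funext l
  refine ConcreteCategory.hom_ext _ _ fun d => ?_
  have hd : (SdS.map (maxChain c ≫ f)).app l d ∈ (imageSubcomplex SdS (horn n i)).obj l :=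
    ⟨_, _, hc, d, rfl⟩
  refine Eq.trans (congrArg (h.app l) (a₂ := ⟨_, hd⟩) (Subtype.ext
    (congrArg (fun φ : SdS.obj k.unop ⟶ SdS.obj ⦋n⦌ => φ.app l d) key))) ?_
  refine (hh _ hc d hd).trans ?_
  exact congrArg (fun φ : SdS.obj k.unop ⟶ Y => φ.app l d) (evalHom_comp y (maxChain c) f ha hc)

end

lemma nu_ι (X : SSet.{0}) (k : ℕ) :
    nu (ExIter X k) ≫ colimit.ι (ExInftyDiagram X) (k + 1) = colimit.ι (ExInftyDiagram X) k := by
  refine Eq.trans ?_ (colimit.w (ExInftyDiagram X) (homOfLE k.le_succ))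
  exact congrArg (· ≫ colimit.ι (ExInftyDiagram X) (k + 1))
    (Functor.ofSequence_map_homOfLE_succ (fun n => nu (ExIter X n)) k).symm

theorem kanComplex_exInfty (X : SSet.{0}) : KanComplex (ExInfty X) := by
  intro n i
  refine ⟨fun {u v} sq => ?_⟩
  have := Cardinal.fact_isRegular_aleph0.{0}
  have : IsCardinalFiltered ℕ Cardinal.aleph0.{0} :=
    (isCardinalFiltered_aleph0_iff ℕ).2 inferInstance
  obtain ⟨k, u, rfl⟩ := IsCardinalPresentable.exists_hom_of_isColimit Cardinal.aleph0.{0}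
    (colimit.isColimit (ExInftyDiagram X)) u
  obtain ⟨z, hz⟩ := exists_extension_nu (Y := ExIter X k) i n.succ_pos (u ≫ nu (ExIter X k))
  refine ⟨⟨{ l := z ≫ colimit.ι (ExInftyDiagram X) (k + 2), fac_left := ?_,
             fac_right := isTerminalPt.hom_ext _ _ }⟩⟩
  refine (congrArg (· ≫ colimit.ι (ExInftyDiagram X) (k + 2)) hz).trans ?_
  refine (congrArg ((u ≫ nu (ExIter X k)) ≫ ·) (nu_ι X (k + 1))).trans ?_
  exact congrArg (u ≫ ·) (nu_ι X k)

end Paper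

/-- For every simplicial set `X`, `Ex^∞ X` is a Kan complex and
`ν^∞_X : X ⟶ Ex^∞ X` is a weak homotopy equivalence. -/
theorem ExInfty_kanComplex_and_nuInfty_weakHomotopyEquivalence (X : SSet.{0}) :
    Paper.KanComplex (Paper.ExInfty X) ∧
    Paper.WeakHomotopyEquivalence (Paper.nuInfty X) :=
  ⟨Paper.kanComplex_exInfty X, (Paper.anodyne_nuInfty X).weakHomotopyEquivalence⟩
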